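/- Let F be a field of characteristic 2, let φ be an anisotropic quadratic form over F of dimension 5 and type (1,3) that is not a Pfister neighbour, and let ψ be an anisotropic nonsingular quadratic form over F of type (2,0) (dimension 4) with nontrivial Arf invariant Δ(ψ)≠0. Then the scalar extension φ_{F(ψ)} of φ to the function field F(ψ) is anisotropic. -/

import Mathlib

open QuadraticMap MvPolynomial
open scoped TensorProduct

set_option synthInstance.maxHeartbeats 1000000
set_option maxHeartbeats 1000000


section Defs

variable {K : Type} [CommRing K]

/-- The binary quadratic form `[a,b] : (x,y) ↦ a·x² + x·y + b·y²`. -/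
noncomputable def binQF (a b : K) : QuadraticForm K (Fin 2 → K) :=
  (Matrix.of ![![a, 1], ![0, b]]).toQuadraticMap'

/-- The diagonal (totally singular) quadratic form `⟨c₁, …, c_s⟩`. -/
noncomputable def diagQF {s : ℕ} (c : Fin s → K) : QuadraticForm K (Fin s → K) :=
  QuadraticMap.weightedSumSquares K c

/-- The orthogonal sum `[a₁,b₁] ⊥ ⋯ ⊥ [a_r,b_r]` of binary forms. -/
noncomputable def binsQF {r : ℕ} (a b : Fin r → K) : QuadraticForm K (Fin r → Fin 2 → K) :=
  QuadraticMap.pi fun i => binQF (a i) (b i)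

/-- The orthogonal sum of `m` hyperbolic planes `[0,0]`. -/
noncomputable def hypQF (K : Type) [CommRing K] (m : ℕ) :
    QuadraticForm K (Fin m → Fin 2 → K) :=
  binsQF (fun _ => 0) (fun _ => 0)

/-- The `(n+1)`-fold quadratic Pfister form `⟨⟨a₁,…,aₙ⟩⟩_b ⊗ [1,c]`, i.e. the orthogonal
sum over all subsets `S ⊆ {1,…,n}` of `(∏_{i∈S} aᵢ)·[1,c]`. -/
noncomputable def pfisterQF (n : ℕ) (a : Fin n → K) (c : K) :
    QuadraticForm K (Finset (Fin n) → Fin 2 → K) :=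
  QuadraticMap.pi fun S : Finset (Fin n) => (∏ i ∈ S, a i) • binQF 1 c

variable {V W : Type} [AddCommGroup V] [Module K V] [AddCommGroup W] [Module K W]

/-- `φ` has type `(r,s)`: it is isometric to `[a₁,b₁] ⊥ ⋯ ⊥ [a_r,b_r] ⊥ ⟨c₁,…,c_s⟩`. -/
def HasTypeRS (φ : QuadraticForm K V) (r s : ℕ) : Prop :=
  ∃ (a b : Fin r → K) (c : Fin s → K), φ.Equivalent ((binsQF a b).prod (diagQF c))

/-- `φ` is dominated by `ψ`. -/
def Dominated (φ : QuadraticForm K V) (ψ : QuadraticForm K W) : Prop :=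
  ∃ f : V →ₗ[K] W, Function.Injective f ∧ ∀ v, φ v = ψ (f v)

/-- `φ` is weakly dominated by `ψ`: `α·φ` is dominated by `ψ` for some unit `α`. -/
def WeaklyDominated (φ : QuadraticForm K V) (ψ : QuadraticForm K W) : Prop :=
  ∃ α : Kˣ, Dominated ((α : K) • φ) ψ

/-- Witt equivalence of quadratic forms. -/
def WittEquiv (Q₁ : QuadraticForm K V) (Q₂ : QuadraticForm K W) : Prop :=
  ∃ k l : ℕ, (Q₁.prod (hypQF K k)).Equivalent (Q₂.prod (hypQF K l))

/-- `φ` is a Pfister neighbour: there is a quadratic Pfister form `π` with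
`2·dim φ > dim π` and `φ ≺_w π`. -/
def IsPfisterNeighbour (φ : QuadraticForm K V) : Prop :=
  ∃ (n : ℕ) (a : Fin n → Kˣ) (c : K),
    2 * Module.finrank K V > 2 ^ (n + 1) ∧
      WeaklyDominated φ (pfisterQF n (fun i => (a i : K)) c)

/-- The Artin–Schreier set `℘(K) = {t² + t : t ∈ K}`. -/
def ArtinSchreier (K : Type) [CommRing K] : Set K := {x : K | ∃ t : K, x = t ^ 2 + t}

end Defs

section FunField

variable (F : Type) [Field F]

/-- The coefficient matrix of a quadratic form on `Fin n → F` with respect to the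
standard basis: diagonal entries `ψ(eᵢ)`, above-diagonal entries `b_ψ(eᵢ,eⱼ)`. -/
noncomputable def coeffMat {n : ℕ} (ψ : QuadraticForm F (Fin n → F)) :
    Matrix (Fin n) (Fin n) F :=
  Matrix.of fun i j =>
    if i = j then ψ (Pi.single i 1)
    else if i < j then polar ψ (Pi.single i 1) (Pi.single j 1) else 0

/-- The homogeneous degree 2 polynomial `P_ψ` associated to a quadratic form `ψ`. -/
noncomputable def qfPoly {n : ℕ} (ψ : QuadraticForm F (Fin n → F)) :
    MvPolynomial (Fin n) F :=
  ∑ i : Fin n, ∑ j : Fin n, MvPolynomial.C (coeffMat F ψ i j) * (X i * X j)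

/-- The affine coordinate ring `F[x₁,…,xₙ]/(P_ψ)` of the quadric `ψ = 0`. -/
def FunFieldRing {n : ℕ} (ψ : QuadraticForm F (Fin n → F)) : Type :=
  MvPolynomial (Fin n) F ⧸ Ideal.span {qfPoly F ψ}

noncomputable instance {n : ℕ} (ψ : QuadraticForm F (Fin n → F)) :
    CommRing (FunFieldRing F ψ) :=
  inferInstanceAs (CommRing (MvPolynomial (Fin n) F ⧸ Ideal.span {qfPoly F ψ}))

noncomputable instance {n : ℕ} (ψ : QuadraticForm F (Fin n → F)) :
    Algebra F (FunFieldRing F ψ) :=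
  inferInstanceAs (Algebra F (MvPolynomial (Fin n) F ⧸ Ideal.span {qfPoly F ψ}))

/-- The function field `F(ψ)` of the quadric `ψ = 0`. -/
def FunField {n : ℕ} (ψ : QuadraticForm F (Fin n → F)) : Type :=
  FractionRing (FunFieldRing F ψ)

noncomputable instance {n : ℕ} (ψ : QuadraticForm F (Fin n → F)) :
    CommRing (FunField F ψ) :=
  inferInstanceAs (CommRing (FractionRing (FunFieldRing F ψ)))

noncomputable instance {n : ℕ} (ψ : QuadraticForm F (Fin n → F)) :
    Algebra (FunFieldRing F ψ) (FunField F ψ) :=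
  inferInstanceAs (Algebra (FunFieldRing F ψ) (FractionRing (FunFieldRing F ψ)))

noncomputable instance {n : ℕ} (ψ : QuadraticForm F (Fin n → F)) :
    Algebra F (FunField F ψ) :=
  inferInstanceAs (Algebra F (FractionRing (FunFieldRing F ψ)))

/-- The canonical map `F → F(ψ)`. -/
noncomputable def funFieldMap {n : ℕ} (ψ : QuadraticForm F (Fin n → F)) :
    F →+* FunField F ψ :=
  algebraMap F (FunField F ψ)

/-- Scalar extension of a quadratic form on `Fin n → F` along a ring homomorphism
`f : F → K`. -/
noncomputable def extendQF {K : Type} [CommRing K] (f : F →+* K) {n : ℕ}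
    (φ : QuadraticForm F (Fin n → F)) : QuadraticForm K (Fin n → K) :=
  ((coeffMat F φ).map f).toQuadraticMap'

end FunField


section Quat

variable (K : Type) [CommRing K]

/-- Defining relations for the char-2 quaternion algebra `[a,b)`: generators `i,j` with
`i² + i = a`, `j² = b`, `j·i = i·j + j` (i.e. `j·i·j⁻¹ = i + 1`). -/
inductive QuatRel (a b : K) : FreeAlgebra K (Fin 2) → FreeAlgebra K (Fin 2) → Prop
  | i_sq : QuatRel a b (FreeAlgebra.ι K 0 * FreeAlgebra.ι K 0 + FreeAlgebra.ι K 0)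
      (algebraMap K _ a)
  | j_sq : QuatRel a b (FreeAlgebra.ι K 1 * FreeAlgebra.ι K 1) (algebraMap K _ b)
  | swap : QuatRel a b (FreeAlgebra.ι K 1 * FreeAlgebra.ι K 0)
      (FreeAlgebra.ι K 0 * FreeAlgebra.ι K 1 + FreeAlgebra.ι K 1)

/-- The quaternion algebra `[a,b)` over `K` (characteristic two convention). -/
def QuatAlg (a b : K) : Type := RingQuot (QuatRel K a b)

noncomputable instance (a b : K) : Ring (QuatAlg K a b) :=
  inferInstanceAs (Ring (RingQuot (QuatRel K a b)))
noncomputable instance (a b : K) : Algebra K (QuatAlg K a b) :=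
  inferInstanceAs (Algebra K (RingQuot (QuatRel K a b)))

/-- `[a,b)` is split over `K`: isomorphic to the `2×2` matrix algebra. -/
def QuatSplit (a b : K) : Prop :=
  Nonempty (QuatAlg K a b ≃ₐ[K] Matrix (Fin 2) (Fin 2) K)

end Quat

section Sqrt

variable (F : Type) [Field F]

/-- The field `F(√c₁,…,√c_s)` obtained by adjoining square roots of the `cᵢ`
(inside an algebraic closure of `F`). -/
noncomputable def sqrtExt {s : ℕ} (c : Fin s → F) :
    IntermediateField F (AlgebraicClosure F) :=
  IntermediateField.adjoin F
    {y : AlgebraicClosure F | ∃ i, y ^ 2 = algebraMap F (AlgebraicClosure F) (c i)}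

/-- The subfield `F² = {x² : x ∈ F}` of squares of a field of characteristic 2. -/
noncomputable def sqSubfield : Subfield F := Subfield.closure (Set.range fun x : F => x ^ 2)

set_option synthInstance.maxHeartbeats 1000000 in
/-- The norm degree `[F²(cᵢ·cⱼ) : F²]` of a diagonal form `⟨c₁,…,c_s⟩`. -/
noncomputable def normDegree {s : ℕ} (c : Fin s → F) : ℕ :=
  Module.finrank (sqSubfield F)
    (IntermediateField.adjoin (sqSubfield F)
      (Set.range fun p : Fin s × Fin s => c p.1 * c p.2))

end Sqrt

/-- A ring is a division algebra if it is nontrivial and every nonzero element is a unit. -/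
def IsDivisionAlgebra (T : Type) [Ring T] : Prop :=
  (0 : T) ≠ 1 ∧ ∀ x : T, x ≠ 0 → IsUnit x



section MatForm

/-- A nonzero family of polynomials is a power of the variable times a family with a nonzero
constant term. -/
theorem exists_eq_X_pow_mul {ι R : Type*} [CommRing R] (v : ι → Polynomial R) (hv : v ≠ 0) :
    ∃ (m : ℕ) (w : ι → Polynomial R), (∀ i, v i = Polynomial.X ^ m * w i) ∧
      ∃ i, (w i).eval 0 ≠ 0 := by
  classical
  let p : ℕ → Prop := fun m => ∃ i, (v i).coeff m ≠ 0
  have hp : ∃ m, p m := by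
    obtain ⟨i, hi⟩ := Function.ne_iff.1 hv
    refine ⟨(v i).natDegree, i, ?_⟩
    simpa using hi
  refine ⟨Nat.find hp, ?_⟩
  have hdvd : ∀ i, Polynomial.X ^ Nat.find hp ∣ v i := by
    intro i
    rw [Polynomial.X_pow_dvd_iff]
    intro d hd
    by_contra h
    exact Nat.find_min hp hd ⟨i, h⟩
  choose w hw using hdvd
  refine ⟨w, hw, ?_⟩
  obtain ⟨i, hi⟩ := Nat.find_spec hp
  refine ⟨i, ?_⟩
  rw [hw i, Polynomial.coeff_X_pow_mul', if_pos le_rfl, Nat.sub_self,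
    Polynomial.coeff_zero_eq_eval_zero] at hi
  exact hi

variable {ι R S : Type*} [Fintype ι] [DecidableEq ι] [CommRing R] [CommRing S]

theorem toQuadraticForm'_eq_sum (A : Matrix ι ι R) (v : ι → R) :
    A.toQuadraticForm' v = ∑ i, ∑ j, A i j * (v i * v j) := by
  simp only [Matrix.toQuadraticForm', LinearMap.BilinMap.toQuadraticMap_apply,
    Matrix.toLinearMap₂'_apply, smul_eq_mul]
  refine Finset.sum_congr rfl fun i _ => Finset.sum_congr rfl fun j _ => ?_
  ring

theorem map_toQuadraticForm'_apply (f : R →+* S) (A : Matrix ι ι R) (v : ι → R) :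
    (A.map f).toQuadraticForm' (fun i => f (v i)) = f (A.toQuadraticForm' v) := by
  simp [toQuadraticForm'_eq_sum]

theorem map_map_toQuadraticForm'_apply {T : Type*} [CommRing T] (g : S →+* T) (f : R →+* S)
    (A : Matrix ι ι R) (v : ι → S) :
    (A.map (g.comp f)).toQuadraticForm' (fun i => g (v i)) =
      g ((A.map f).toQuadraticForm' v) := by
  simp [toQuadraticForm'_eq_sum]

theorem anisotropic_map_C [IsDomain R] (A : Matrix ι ι R) (hA : A.toQuadraticForm'.Anisotropic) :
    (A.map (Polynomial.C : R →+* Polynomial R)).toQuadraticForm'.Anisotropic := by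
  intro v hv
  by_contra h
  obtain ⟨m, w, hw, i, hi⟩ := exists_eq_X_pow_mul v h
  have hvw : v = (Polynomial.X ^ m : Polynomial R) • w := by
    ext1 i; simp [hw i]
  rw [hvw, QuadraticMap.map_smul, smul_eq_mul] at hv
  have h0 : (A.map (Polynomial.C : R →+* Polynomial R)).toQuadraticForm' w = 0 := by
    rcases mul_eq_zero.1 hv with h' | h'
    · exact absurd h' (by simp)
    · exact h'
  have h1 := map_map_toQuadraticForm'_apply (Polynomial.evalRingHom (0 : R)) Polynomial.C A w
  rw [h0, map_zero] at h1
  have h2 : (A.map ((Polynomial.evalRingHom (0 : R)).comp Polynomial.C)) = A := by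
    ext; simp
  rw [h2] at h1
  exact hi (congrFun (hA _ h1) i)

theorem anisotropic_map_algebraMap {K : Type*} [Field K] [IsDomain R] [Algebra R K]
    [IsFractionRing R K] (A : Matrix ι ι R) (hA : A.toQuadraticForm'.Anisotropic) :
    (A.map (algebraMap R K)).toQuadraticForm'.Anisotropic := by
  intro v hv
  obtain ⟨b, hb⟩ := IsLocalization.exist_integer_multiples_of_finite (nonZeroDivisors R) v
  choose w hw using hb
  have hb0 : algebraMap R K b ≠ 0 := by
    simp
  have hvw : (fun i => algebraMap R K (w i)) = algebraMap R K b • v := by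
    ext1 i
    simp [hw i, Algebra.smul_def]
  have h1 := map_toQuadraticForm'_apply (algebraMap R K) A w
  rw [hvw, QuadraticMap.map_smul, hv, smul_zero, eq_comm,
    map_eq_zero_iff _ (IsFractionRing.injective R K)] at h1
  have h2 := hA _ h1
  ext1 i
  have := congrFun hvw i
  simp only [h2, Pi.zero_apply, map_zero, Pi.smul_apply, smul_eq_mul] at this
  exact (mul_eq_zero.1 this.symm).resolve_left hb0

theorem coeff_two_mul_map_C (A : Matrix ι ι R) (v : ι → Polynomial R) (N : ℕ)
    (hN : ∀ i, (v i).natDegree ≤ N) :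
    ((A.map (Polynomial.C : R →+* Polynomial R)).toQuadraticForm' v).coeff (2 * N) =
      A.toQuadraticForm' fun i => (v i).coeff N := by
  simp only [toQuadraticForm'_eq_sum, Polynomial.finsetSum_coeff, Matrix.map_apply,
    Polynomial.coeff_C_mul, two_mul]
  refine Finset.sum_congr rfl fun i _ => Finset.sum_congr rfl fun j _ => ?_
  rw [Polynomial.coeff_mul_add_eq_of_natDegree_le (hN i) (hN j)]

theorem two_mul_natDegree_le (A : Matrix ι ι R) (hA : A.toQuadraticForm'.Anisotropic)
    (v : ι → Polynomial R) (i : ι) :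
    2 * (v i).natDegree ≤
      ((A.map (Polynomial.C : R →+* Polynomial R)).toQuadraticForm' v).natDegree := by
  obtain ⟨j, -, hj⟩ := Finset.exists_max_image Finset.univ (fun i => (v i).natDegree)
    ⟨i, Finset.mem_univ i⟩
  refine (Nat.mul_le_mul_left 2 (hj i (Finset.mem_univ i))).trans ?_
  by_cases hvj : v j = 0
  · simp [hvj]
  apply Polynomial.le_natDegree_of_ne_zero
  rw [coeff_two_mul_map_C A v _ fun i => hj i (Finset.mem_univ i)]
  intro h
  have := congrFun (hA _ h) j
  simp at this
  exact hvj this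

theorem degree_map_C_lt (A : Matrix ι ι R) (v : ι → Polynomial R) (N : ℕ)
    (hN : ∀ i, (v i).degree < N) :
    ((A.map (Polynomial.C : R →+* Polynomial R)).toQuadraticForm' v).degree < (2 * N : ℕ) := by
  rw [toQuadraticForm'_eq_sum]
  rw [← Polynomial.mem_degreeLT]
  refine Submodule.sum_mem _ fun i _ => Submodule.sum_mem _ fun j _ => ?_
  rw [Matrix.map_apply, Polynomial.mem_degreeLT]
  rw [Polynomial.degree_lt_iff_coeff_zero]
  intro m hm
  rw [Polynomial.coeff_C_mul]
  have : (v i * v j).degree < (2 * N : ℕ) := by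
    by_cases hi : v i = 0
    · rw [hi, zero_mul, Polynomial.degree_zero]
      exact WithBot.bot_lt_coe (2 * N)
    · refine (Polynomial.degree_mul_le _ _).trans_lt ?_
      rw [two_mul, Nat.cast_add]
      exact WithBot.add_lt_add_of_le_of_lt (by simpa using hi) (hN i).le (hN j)
  rw [Polynomial.coeff_eq_zero_of_degree_lt (this.trans_le (by exact_mod_cast hm)), mul_zero]

/-- Descent in the style of Cassels and Pfister: a solution in rational functions of the
inhomogeneous quadratic equation `Φ v + ℓ v + c = 0`, with `Φ` anisotropic over the constants,
yields a polynomial solution. -/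
theorem exists_polynomial_solution {k : Type*} [Field k] [CharP k 2]
    (A : Matrix ι ι k) (hA : A.toQuadraticForm'.Anisotropic)
    (ℓ : (ι → Polynomial k) →ₗ[Polynomial k] Polynomial k) (c : Polynomial k) :
    ∀ (n : ℕ) (v : ι → Polynomial k) (h : Polynomial k), h ≠ 0 → h.natDegree ≤ n →
      (A.map (Polynomial.C : k →+* Polynomial k)).toQuadraticForm' v + ℓ v * h + c * h ^ 2 = 0 →
      ∃ w, (A.map (Polynomial.C : k →+* Polynomial k)).toQuadraticForm' w + ℓ w + c = 0 := by
  set Φ := (A.map (Polynomial.C : k →+* Polynomial k)).toQuadraticForm' with hΦ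
  have hanis : Φ.Anisotropic := anisotropic_map_C A hA
  have h2 : (2 : Polynomial k) = 0 := CharTwo.two_eq_zero
  intro n
  induction n using Nat.strong_induction_on with
  | _ n ih =>
  intro v h hh hn hv
  set q : ι → Polynomial k := fun i => v i / h with hq
  set r : ι → Polynomial k := fun i => v i % h with hr
  have hvqr : v = h • q + r := by
    ext1 i
    simp [hq, hr, EuclideanDomain.div_add_mod]
  set ε := Φ q + ℓ q + c with hε
  set β := polar Φ r q + ℓ r with hβ
  have hpol : Φ v = h ^ 2 * Φ q + Φ r + h * polar Φ r q := by
    rw [hvqr, QuadraticMap.map_add Φ, QuadraticMap.map_smul, QuadraticMap.polar_smul_left,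
      QuadraticMap.polar_comm Φ q r]
    simp only [smul_eq_mul]; ring
  have hℓ : ℓ v = h * ℓ q + ℓ r := by
    rw [hvqr, map_add, map_smul, smul_eq_mul]
  have key : h * (h * ε + β) = Φ r := by
    rw [hpol, hℓ] at hv
    rw [hε, hβ]
    linear_combination hv - Φ r * h2
  by_cases hr0 : r = 0
  · refine ⟨q, ?_⟩
    have : h * (h * ε) = 0 := by
      rw [hr0] at key hβ
      simpa [hβ] using key
    simpa [hh] using this
  have hΦr : Φ r ≠ 0 := fun h' => hr0 (hanis _ h')
  have hh' : h * ε + β ≠ 0 := by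
    intro h'
    rw [h', mul_zero] at key
    exact hΦr key.symm
  have hdeg : (Φ r).degree < (2 * h.natDegree : ℕ) := by
    refine degree_map_C_lt A r _ fun i => ?_
    rw [← Polynomial.degree_eq_natDegree hh]
    exact Polynomial.degree_mod_lt _ hh
  have hlt : (h * ε + β).natDegree < h.natDegree := by
    rw [← key, Polynomial.degree_eq_natDegree (mul_ne_zero hh hh'),
      Polynomial.natDegree_mul hh hh'] at hdeg
    have : h.natDegree + (h * ε + β).natDegree < 2 * h.natDegree := by exact_mod_cast hdeg
    omega
  refine ih _ (hlt.trans_le hn) (ε • v + β • q) (h * ε + β) hh' le_rfl ?_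
  have hpvq : polar Φ v q = polar Φ r q := by
    rw [hvqr, QuadraticMap.polar_add_left, QuadraticMap.polar_smul_left, QuadraticMap.polar_self]
    simp only [smul_eq_mul]
    linear_combination h * Φ q * h2
  rw [QuadraticMap.map_add Φ, QuadraticMap.map_smul, QuadraticMap.map_smul,
    QuadraticMap.polar_smul_left, QuadraticMap.polar_smul_right, hpvq, map_add, map_smul, map_smul]
  simp only [smul_eq_mul]
  have e1 : polar Φ r q = β - ℓ r := by rw [hβ]; ring
  have e2 : Φ q = ε - ℓ q - c := by rw [hε]; ring
  rw [e1, e2, hℓ]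
  rw [hℓ] at hv
  linear_combination ε ^ 2 * hv + (β ^ 2 * ε + ε * h * c * β + ε * β * h * ℓ q) * h2

end MatForm

section Conic

/-- The Gram matrix of the ternary form `z² + a·u² + e·uv + b·v²`. -/
def conicMat {R : Type*} [CommRing R] (a e b : R) : Matrix (Fin 3) (Fin 3) R :=
  !![1, 0, 0; 0, a, e; 0, 0, b]

/-- The Gram matrix of the binary form `a·u² + e·uv + b·v²`. -/
def planeMat {R : Type*} [CommRing R] (a e b : R) : Matrix (Fin 2) (Fin 2) R :=
  !![a, e; 0, b]

variable {R S : Type*} [CommRing R] [CommRing S]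

theorem conicMat_apply (a e b : R) (x : Fin 3 → R) :
    (conicMat a e b).toQuadraticForm' x =
      x 0 ^ 2 + a * x 1 ^ 2 + e * (x 1 * x 2) + b * x 2 ^ 2 := by
  simp [toQuadraticForm'_eq_sum, conicMat, Fin.sum_univ_three]
  ring

theorem planeMat_apply (a e b : R) (x : Fin 2 → R) :
    (planeMat a e b).toQuadraticForm' x =
      a * x 0 ^ 2 + e * (x 0 * x 1) + b * x 1 ^ 2 := by
  simp [toQuadraticForm'_eq_sum, planeMat, Fin.sum_univ_two]
  ring

theorem conicMat_map (f : R →+* S) (a e b : R) :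
    (conicMat a e b).map f = conicMat (f a) (f e) (f b) := by
  ext i j
  fin_cases i <;> fin_cases j <;> simp [conicMat]

theorem planeMat_map (f : R →+* S) (a e b : R) :
    (planeMat a e b).map f = planeMat (f a) (f e) (f b) := by
  ext i j
  fin_cases i <;> fin_cases j <;> simp [planeMat]

theorem planeMat_anisotropic_of_conicMat {a e b : R}
    (h : (conicMat a e b).toQuadraticForm'.Anisotropic) :
    (planeMat a e b).toQuadraticForm'.Anisotropic := by
  intro x hx
  have h1 := h ![0, x 0, x 1] (by
    rw [planeMat_apply] at hx
    rw [conicMat_apply]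
    simpa using hx)
  ext i
  fin_cases i
  · simpa using congrFun h1 1
  · simpa using congrFun h1 2

theorem quadratic_eq_zero {p q r : R}
    (h : Polynomial.C p * Polynomial.X ^ 2 + Polynomial.C q * Polynomial.X +
      Polynomial.C r = 0) : p = 0 ∧ q = 0 ∧ r = 0 := by
  refine ⟨?_, ?_, ?_⟩
  · simpa [Polynomial.coeff_X, Polynomial.coeff_C] using congrArg (Polynomial.coeff · 2) h
  · simpa [Polynomial.coeff_X, Polynomial.coeff_C] using congrArg (Polynomial.coeff · 1) h
  · simpa using congrArg (Polynomial.coeff · 0) h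

/-- If `z² + n·N(u,v)`, with `N = [1,d]`, is anisotropic over `k` and
`α² + α + n·N(β) = g·X²` is solvable in rational functions, then `g` is a value of `n·N`. -/
theorem exists_norm_eq_of_rational_solution {k : Type*} [Field k] [CharP k 2] {n d g : k}
    (hanis : (conicMat n n (n * d)).toQuadraticForm'.Anisotropic)
    {A B₀ B₁ h : Polynomial k} (hh : h ≠ 0)
    (heq : A ^ 2 + A * h + Polynomial.C n * (B₀ ^ 2 + B₀ * B₁ + Polynomial.C d * B₁ ^ 2) =
      Polynomial.C g * Polynomial.X ^ 2 * h ^ 2) :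
    ∃ x y : k, n * (x ^ 2 + x * y + d * y ^ 2) = g := by
  have h2p : (2 : Polynomial k) = 0 := CharTwo.two_eq_zero
  have h2 : (2 : k) = 0 := CharTwo.two_eq_zero
  obtain ⟨w, hw⟩ := exists_polynomial_solution (conicMat n n (n * d)) hanis
    (LinearMap.proj 0) (Polynomial.C g * Polynomial.X ^ 2) h.natDegree ![A, B₀, B₁] h hh le_rfl (by
      rw [conicMat_map, conicMat_apply]
      simp only [Polynomial.C_mul, LinearMap.proj_apply, Matrix.cons_val]
      linear_combination heq + Polynomial.C g * Polynomial.X ^ 2 * h ^ 2 * h2p)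
  have hΦ : ((conicMat n n (n * d)).map
      (Polynomial.C : k →+* Polynomial k)).toQuadraticForm' w =
      w 0 + Polynomial.C g * Polynomial.X ^ 2 := by
    simp only [LinearMap.proj_apply] at hw
    linear_combination hw - (w 0 + Polynomial.C g * Polynomial.X ^ 2) * h2p
  have hdeg := two_mul_natDegree_le _ hanis w
  have hX2 : (Polynomial.C g * Polynomial.X ^ 2).natDegree ≤ 2 :=
    Polynomial.natDegree_C_mul_X_pow_le g 2
  have hle : ∀ i, (w i).natDegree ≤ 1 := by
    have hub : (w 0 + Polynomial.C g * Polynomial.X ^ 2).natDegree ≤ max (w 0).natDegree 2 :=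
      (Polynomial.natDegree_add_le _ _).trans (max_le_max le_rfl hX2)
    rw [hΦ] at hdeg
    have h0 := hdeg 0
    intro i
    have hi := hdeg i
    omega
  have hlin : ∀ i, w i =
      Polynomial.C ((w i).coeff 1) * Polynomial.X + Polynomial.C ((w i).coeff 0) := fun i =>
    Polynomial.eq_X_add_C_of_natDegree_le_one (hle i)
  obtain ⟨a₁, a₀, ha⟩ : ∃ p q, w 0 = Polynomial.C p * Polynomial.X + Polynomial.C q :=
    ⟨_, _, hlin 0⟩
  obtain ⟨b₁, b₀, hb⟩ : ∃ p q, w 1 = Polynomial.C p * Polynomial.X + Polynomial.C q :=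
    ⟨_, _, hlin 1⟩
  obtain ⟨c₁, c₀, hc⟩ : ∃ p q, w 2 = Polynomial.C p * Polynomial.X + Polynomial.C q :=
    ⟨_, _, hlin 2⟩
  rw [conicMat_map, conicMat_apply, ha, hb, hc] at hΦ
  have hpoly : Polynomial.C (a₁ ^ 2 + n * (b₁ ^ 2 + b₁ * c₁ + d * c₁ ^ 2) - g) * Polynomial.X ^ 2 +
      Polynomial.C (n * (b₁ * c₀ + b₀ * c₁) - a₁) * Polynomial.X +
      Polynomial.C (a₀ ^ 2 - a₀ + n * (b₀ ^ 2 + b₀ * c₀ + d * c₀ ^ 2)) = 0 := by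
    simp only [map_add, map_sub, map_mul, map_pow] at hΦ ⊢
    linear_combination hΦ - (Polynomial.C a₁ * Polynomial.C a₀ * Polynomial.X +
      Polynomial.C n * Polynomial.C b₁ * Polynomial.C b₀ * Polynomial.X +
      Polynomial.C n * Polynomial.C d * Polynomial.C c₁ * Polynomial.C c₀ * Polynomial.X) * h2p
  obtain ⟨e2, e1, e0⟩ := quadratic_eq_zero hpoly
  by_cases ha₀ : 1 + a₀ = 0
  · have ha₀' : a₀ = 1 := by linear_combination ha₀ - h2
    have hz := hanis ![0, b₀, c₀] (by
      rw [conicMat_apply]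
      simp only [Matrix.cons_val]
      rw [ha₀'] at e0
      linear_combination e0)
    have hb₀ : b₀ = 0 := by simpa using congrFun hz 1
    have hc₀ : c₀ = 0 := by simpa using congrFun hz 2
    have ha₁ : a₁ = 0 := by rw [hb₀, hc₀] at e1; linear_combination -e1
    exact ⟨b₁, c₁, by rw [ha₁] at e2; linear_combination e2⟩
  · refine ⟨b₁ + a₁ * b₀ / (1 + a₀), c₁ + a₁ * c₀ / (1 + a₀), ?_⟩
    field_simp
    have e3 : n * (b₁ ^ 2 + b₁ * c₁ + d * c₁ ^ 2) = g - a₁ ^ 2 := by linear_combination e2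
    have e4 : n * (b₀ ^ 2 + b₀ * c₀ + d * c₀ ^ 2) = a₀ - a₀ ^ 2 := by linear_combination e0
    have e5 : n * (b₁ * c₀ + b₀ * c₁) = a₁ := by linear_combination e1
    linear_combination (1 + a₀) ^ 2 * e3 + a₁ ^ 2 * e4 + (1 + a₀) * a₁ * e5 +
      (1 + a₀) * a₁ * n * (b₁ * b₀ + d * c₁ * c₀) * h2 - a₀ ^ 2 * a₁ ^ 2 * h2

/-- If a scalar multiple of the norm form `[1,d]` represents a nonzero multiple of
`a·T² + T + b` over `L(T)`, then `d + ab` lies in the Artin–Schreier set. -/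
theorem artinSchreier_of_norm_eq {L : Type*} [Field L] [CharP L 2] {n d a b α : L} (hα : α ≠ 0)
    (hanis : (planeMat n n (n * d)).toQuadraticForm'.Anisotropic)
    {B₀ B₁ h : Polynomial L} (hh : h ≠ 0)
    (heq : Polynomial.C n * (B₀ ^ 2 + B₀ * B₁ + Polynomial.C d * B₁ ^ 2) =
      Polynomial.C α * (Polynomial.C a * Polynomial.X ^ 2 + Polynomial.X + Polynomial.C b) *
        h ^ 2) :
    ∃ s : L, d + a * b = s ^ 2 + s := by
  have h2p : (2 : Polynomial L) = 0 := CharTwo.two_eq_zero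
  have h2 : (2 : L) = 0 := CharTwo.two_eq_zero
  set f : Polynomial L :=
    Polynomial.C α * (Polynomial.C a * Polynomial.X ^ 2 + Polynomial.X + Polynomial.C b) with hf
  obtain ⟨w, hw⟩ := exists_polynomial_solution (planeMat n n (n * d)) hanis
    0 f h.natDegree ![B₀, B₁] h hh le_rfl (by
      rw [planeMat_map, planeMat_apply]
      simp only [Polynomial.C_mul, LinearMap.zero_apply, Matrix.cons_val]
      linear_combination heq + f * h ^ 2 * h2p)
  have hΦ : ((planeMat n n (n * d)).map
      (Polynomial.C : L →+* Polynomial L)).toQuadraticForm' w = f := by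
    simp only [LinearMap.zero_apply] at hw
    linear_combination hw - f * h2p
  have hdeg := two_mul_natDegree_le _ hanis w
  have hfdeg : f.natDegree ≤ 2 := by
    rw [hf]; compute_degree
  have hle : ∀ i, (w i).natDegree ≤ 1 := by
    intro i
    have hi := hdeg i
    rw [hΦ] at hi
    omega
  have hlin : ∀ i, w i =
      Polynomial.C ((w i).coeff 1) * Polynomial.X + Polynomial.C ((w i).coeff 0) := fun i =>
    Polynomial.eq_X_add_C_of_natDegree_le_one (hle i)
  obtain ⟨b₁, b₀, hb⟩ : ∃ p q, w 0 = Polynomial.C p * Polynomial.X + Polynomial.C q :=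
    ⟨_, _, hlin 0⟩
  obtain ⟨c₁, c₀, hc⟩ : ∃ p q, w 1 = Polynomial.C p * Polynomial.X + Polynomial.C q :=
    ⟨_, _, hlin 1⟩
  rw [planeMat_map, planeMat_apply, hb, hc, hf] at hΦ
  have hpoly : Polynomial.C (n * (b₁ ^ 2 + b₁ * c₁ + d * c₁ ^ 2) - α * a) * Polynomial.X ^ 2 +
      Polynomial.C (n * (b₁ * c₀ + b₀ * c₁) - α) * Polynomial.X +
      Polynomial.C (n * (b₀ ^ 2 + b₀ * c₀ + d * c₀ ^ 2) - α * b) = 0 := by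
    simp only [map_add, map_sub, map_mul, map_pow] at hΦ ⊢
    linear_combination hΦ - (
      Polynomial.C n * Polynomial.C b₁ * Polynomial.C b₀ * Polynomial.X +
      Polynomial.C n * Polynomial.C d * Polynomial.C c₁ * Polynomial.C c₀ * Polynomial.X) * h2p
  obtain ⟨e2, e1, e0⟩ := quadratic_eq_zero hpoly
  set β := b₁ * c₀ + b₀ * c₁ with hβ
  have hnβ : n * β = α := by linear_combination e1
  have hβ0 : β ≠ 0 := by rintro h'; exact hα (by rw [← hnβ, h', mul_zero])
  have hn0 : n ≠ 0 := by rintro h'; exact hα (by rw [← hnβ, h', zero_mul])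
  refine ⟨(b₁ * b₀ + b₁ * c₀ + d * c₁ * c₀) / β, ?_⟩
  have e0' : b₀ ^ 2 + b₀ * c₀ + d * c₀ ^ 2 = β * b := by
    apply mul_left_cancel₀ hn0; linear_combination e0 - b * hnβ
  have e2' : b₁ ^ 2 + b₁ * c₁ + d * c₁ ^ 2 = β * a := by
    apply mul_left_cancel₀ hn0; linear_combination e2 - a * hnβ
  have e3 : (b₁ ^ 2 + b₁ * c₁ + d * c₁ ^ 2) * (b₀ ^ 2 + b₀ * c₀ + d * c₀ ^ 2) =
      β ^ 2 * (a * b) := by rw [e0', e2']; ring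
  field_simp
  rw [hβ] at *
  linear_combination (-1 : L) * e3 + (-(d * b₁ * c₀ ^ 2 * c₁) + d * b₁ ^ 2 * c₀ ^ 2 +
    d * b₀ ^ 2 * c₁ ^ 2 - b₁ ^ 2 * c₀ * b₀ - b₁ ^ 2 * c₀ ^ 2) * h2

end Conic

section QuadraticPoint

/-- The vectors `x`, `y` define a point of the conic `τ = z² + a·u² + uv + b·v²` over the
quadratic extension with norm form proportional to `α·ξ² + ξη + e·η²`. -/
def IsQuadraticPoint {R : Type*} [CommRing R] (a b α e : R) (x y : Fin 3 → R) : Prop :=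
  (x ≠ 0 ∨ y ≠ 0) ∧
    α * (x 1 * y 2 + x 2 * y 1) = (conicMat a 1 b).toQuadraticForm' y ∧
    α * (conicMat a 1 b).toQuadraticForm' x = e * (conicMat a 1 b).toQuadraticForm' y

variable {R : Type*} [CommRing R]

theorem IsQuadraticPoint.eval_zero [IsDomain R] {a b α : R} {e : Polynomial R}
    {x y : Fin 3 → Polynomial R}
    (h : IsQuadraticPoint (Polynomial.C a) (Polynomial.C b) (Polynomial.C α) e x y) :
    ∃ x' y', IsQuadraticPoint a b α (e.eval 0) x' y' := by
  obtain ⟨h0, h1, h2⟩ := h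
  have hv : (Sum.elim x y : Fin 3 ⊕ Fin 3 → Polynomial R) ≠ 0 := by
    intro h
    rcases h0 with h0 | h0
    · exact h0 (funext fun i => congrFun h (Sum.inl i))
    · exact h0 (funext fun i => congrFun h (Sum.inr i))
  obtain ⟨m, w, hw, i, hi⟩ := exists_eq_X_pow_mul _ hv
  have hx : ∀ i, x i = Polynomial.X ^ m * w (Sum.inl i) := fun i => hw (Sum.inl i)
  have hy : ∀ i, y i = Polynomial.X ^ m * w (Sum.inr i) := fun i => hw (Sum.inr i)
  have hX : (Polynomial.X ^ m : Polynomial R) ^ 2 ≠ 0 := by simp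
  refine ⟨fun i => (w (Sum.inl i)).eval 0, fun i => (w (Sum.inr i)).eval 0, ?_, ?_, ?_⟩
  · rcases i with i | i
    · exact Or.inl fun h => hi (congrFun h i)
    · exact Or.inr fun h => hi (congrFun h i)
  · simp only [conicMat_apply, hx, hy] at h1 ⊢
    have h1' := mul_left_cancel₀ hX (b := Polynomial.C α *
      (w (Sum.inl 1) * w (Sum.inr 2) + w (Sum.inl 2) * w (Sum.inr 1)))
      (c := w (Sum.inr 0) ^ 2 + Polynomial.C a * w (Sum.inr 1) ^ 2 +
        1 * (w (Sum.inr 1) * w (Sum.inr 2)) + Polynomial.C b * w (Sum.inr 2) ^ 2)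
      (by linear_combination h1)
    simpa using congrArg (Polynomial.eval 0) h1'
  · simp only [conicMat_apply, hx, hy] at h2 ⊢
    have h2' := mul_left_cancel₀ hX (b := Polynomial.C α *
      (w (Sum.inl 0) ^ 2 + Polynomial.C a * w (Sum.inl 1) ^ 2 +
        1 * (w (Sum.inl 1) * w (Sum.inl 2)) + Polynomial.C b * w (Sum.inl 2) ^ 2))
      (c := e * (w (Sum.inr 0) ^ 2 + Polynomial.C a * w (Sum.inr 1) ^ 2 +
        1 * (w (Sum.inr 1) * w (Sum.inr 2)) + Polynomial.C b * w (Sum.inr 2) ^ 2))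
      (by linear_combination h2)
    simpa using congrArg (Polynomial.eval 0) h2'

/-- Coordinates with respect to the basis `(e₀, Y, X)`. -/
theorem exists_basis_coords {n ν : R} (h2 : (2 : R) = 0) (hν : n * ν = 1) {X Y : Fin 3 → R}
    (hXY : X 1 * Y 2 + X 2 * Y 1 = n) (v : Fin 3 → R) :
    ∃ z u t, v 0 = z + u * Y 0 + t * X 0 ∧ v 1 = u * Y 1 + t * X 1 ∧
      v 2 = u * Y 2 + t * X 2 := by
  refine ⟨v 0 - ν * (v 1 * X 2 + v 2 * X 1) * Y 0 - ν * (v 1 * Y 2 + v 2 * Y 1) * X 0,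
    ν * (v 1 * X 2 + v 2 * X 1), ν * (v 1 * Y 2 + v 2 * Y 1), by ring, ?_, ?_⟩
  · linear_combination (-v 1) * hν - v 1 * ν * hXY - ν * v 2 * X 1 * Y 1 * h2
  · linear_combination (-v 2) * hν - v 2 * ν * hXY - ν * v 1 * X 2 * Y 2 * h2

/-- The value of `z² + a·u² + uv + b·v²` in the basis `(e₀, Y, X)`. -/
theorem conicMat_apply_of_coords {a b n d : R} (h2 : (2 : R) = 0) {X Y : Fin 3 → R}
    (hX : (conicMat a 1 b).toQuadraticForm' X = n * d)
    (hY : (conicMat a 1 b).toQuadraticForm' Y = n)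
    (hXY : X 1 * Y 2 + X 2 * Y 1 = n) {v : Fin 3 → R} {z u t : R}
    (h0 : v 0 = z + u * Y 0 + t * X 0) (h1 : v 1 = u * Y 1 + t * X 1)
    (h2' : v 2 = u * Y 2 + t * X 2) :
    (conicMat a 1 b).toQuadraticForm' v = z ^ 2 + n * (u ^ 2 + u * t + d * t ^ 2) := by
  rw [conicMat_apply] at hX hY ⊢
  rw [h0, h1, h2']
  linear_combination t ^ 2 * hX + u ^ 2 * hY + u * t * hXY + (z * u * Y 0 + z * t * X 0 +
    u * t * X 0 * Y 0 + a * u * t * X 1 * Y 1 + b * u * t * X 2 * Y 2) * h2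

theorem IsQuadraticPoint.norm_relation {a b α n d g e ν : R} (h2 : (2 : R) = 0)
    (hν : n * ν = 1) {X Y : Fin 3 → R}
    (hX : (conicMat a 1 b).toQuadraticForm' X = n * d)
    (hY : (conicMat a 1 b).toQuadraticForm' Y = n)
    (hXY : X 1 * Y 2 + X 2 * Y 1 = n) (he : α * e = d + g)
    {x y : Fin 3 → R} (h : IsQuadraticPoint a b α e x y) :
    ∃ A B₀ B₁ : R, A ^ 2 + A * (conicMat a 1 b).toQuadraticForm' y +
        n * (B₀ ^ 2 + B₀ * B₁ + d * B₁ ^ 2) =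
      g * (conicMat a 1 b).toQuadraticForm' y ^ 2 := by
  obtain ⟨-, h3, h4⟩ := h
  obtain ⟨zx, ux, vx, hx0, hx1, hx2⟩ := exists_basis_coords h2 hν hXY (α • x)
  obtain ⟨zy, uy, vy, hy0, hy1, hy2⟩ := exists_basis_coords h2 hν hXY y
  have ex := conicMat_apply_of_coords h2 hX hY hXY hx0 hx1 hx2
  have ey := conicMat_apply_of_coords h2 hX hY hXY hy0 hy1 hy2
  rw [QuadraticMap.map_smul, smul_eq_mul] at ex
  simp only [Pi.smul_apply, smul_eq_mul] at hx1 hx2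
  set H := (conicMat a 1 b).toQuadraticForm' y with hH
  have e1 : n * (ux * vy + vx * uy) = H := by
    linear_combination h3 - (y 2) * hx1 - (y 1) * hx2 - (ux * Y 1 + vx * X 1) * hy2 -
      (ux * Y 2 + vx * X 2) * hy1 - (ux * vy + vx * uy) * hXY -
      (ux * uy * Y 1 * Y 2 + vx * vy * X 1 * X 2) * h2
  have e2 : zx ^ 2 + n * (ux ^ 2 + ux * vx + d * vx ^ 2) = (d + g) * H := by
    linear_combination -ex + α * h4 + H * he
  refine ⟨zx * zy + n * (ux * uy + ux * vy + d * vx * vy), zx * uy + zy * ux,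
    zx * vy + zy * vx, ?_⟩
  have e3 : (zx ^ 2 + n * (ux ^ 2 + ux * vx + d * vx ^ 2)) *
      (zy ^ 2 + n * (uy ^ 2 + uy * vy + d * vy ^ 2)) = (d + g) * H * H := by
    rw [e2, ← ey]
  rw [← e1] at e3 ⊢
  linear_combination e3 + (2*n*ux*uy*zx*zy + 2*n*ux*vy*zx*zy + 2*d*n*vx*vy*zx*zy +
    n^2*ux^2*uy*vy + 2*d*n^2*ux*uy*vx*vy + n^2*ux^2*vy^2 + d*n^2*ux*vx*vy^2 +
    n*uy*vx*zx*zy) * h2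

theorem conicMat_anisotropic_of_point {L : Type*} [Field L] [CharP L 2] {a b n d : L}
    (hτ : (conicMat a 1 b).toQuadraticForm'.Anisotropic) (hn : n ≠ 0) {X Y : Fin 3 → L}
    (hX : (conicMat a 1 b).toQuadraticForm' X = n * d)
    (hY : (conicMat a 1 b).toQuadraticForm' Y = n)
    (hXY : X 1 * Y 2 + X 2 * Y 1 = n) :
    (conicMat n n (n * d)).toQuadraticForm'.Anisotropic := by
  intro v hv
  have h2 : (2 : L) = 0 := CharTwo.two_eq_zero
  rw [conicMat_apply] at hv
  have h0 := hτ ![v 0 + v 1 * Y 0 + v 2 * X 0, v 1 * Y 1 + v 2 * X 1, v 1 * Y 2 + v 2 * X 2] (by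
    rw [conicMat_apply_of_coords h2 hX hY hXY (z := v 0) (u := v 1) (t := v 2) (by simp)
      (by simp) (by simp)]
    linear_combination hv)
  have c0 : v 0 + v 1 * Y 0 + v 2 * X 0 = 0 := congrFun h0 0
  have c1 : v 1 * Y 1 + v 2 * X 1 = 0 := congrFun h0 1
  have c2 : v 1 * Y 2 + v 2 * X 2 = 0 := congrFun h0 2
  have hv1 : v 1 = 0 := by
    have : v 1 * n = 0 := by
      linear_combination X 2 * c1 + X 1 * c2 - v 1 * hXY - v 2 * X 1 * X 2 * h2
    exact (mul_eq_zero.1 this).resolve_right hn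
  have hv2 : v 2 = 0 := by
    have : v 2 * n = 0 := by
      linear_combination Y 2 * c1 + Y 1 * c2 - v 2 * hXY - v 1 * Y 1 * Y 2 * h2
    exact (mul_eq_zero.1 this).resolve_right hn
  have hv0 : v 0 = 0 := by rw [hv1, hv2] at c0; simpa using c0
  ext i
  fin_cases i
  exacts [hv0, hv1, hv2]

theorem IsQuadraticPoint.value_ne_zero [IsDomain R] {a b α e : R} {x y : Fin 3 → R}
    (hτ : (conicMat a 1 b).toQuadraticForm'.Anisotropic) (hα : α ≠ 0)
    (h : IsQuadraticPoint a b α e x y) : (conicMat a 1 b).toQuadraticForm' y ≠ 0 := by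
  intro h0
  obtain ⟨h1, -, h3⟩ := h
  rw [h0, mul_zero] at h3
  have hx := hτ _ ((mul_eq_zero.1 h3).resolve_left hα)
  rcases h1 with h1 | h1
  exacts [h1 hx, h1 (hτ _ h0)]

/-- If the anisotropic conic `z² + a·u² + uv + b·v²` has a point over the function field of the
quadric `α·ξ² + ξη + b₁·η² + (a₂T² + T + b₂)U²·η²`, then `α·b₁ + a₂·b₂` lies in the
Artin–Schreier set. -/
theorem IsQuadraticPoint.artinSchreier {L : Type*} [Field L] [CharP L 2] {a b α b₁ a₂ b₂ : L}
    (hτ : (conicMat a 1 b).toQuadraticForm'.Anisotropic) (hα : α ≠ 0)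
    {x y : Fin 3 → Polynomial (Polynomial L)}
    (h : IsQuadraticPoint (Polynomial.C (Polynomial.C a)) (Polynomial.C (Polynomial.C b))
      (Polynomial.C (Polynomial.C α))
      (Polynomial.C (Polynomial.C b₁) + Polynomial.C (Polynomial.C a₂ * Polynomial.X ^ 2 +
        Polynomial.X + Polynomial.C b₂) * Polynomial.X ^ 2) x y) :
    ∃ s : L, α * b₁ + a₂ * b₂ = s ^ 2 + s := by
  have h2 : (2 : L) = 0 := CharTwo.two_eq_zero
  obtain ⟨x', y', h'⟩ := h.eval_zero
  simp only [Polynomial.eval_add, Polynomial.eval_C, Polynomial.eval_mul, Polynomial.eval_pow,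
    Polynomial.eval_X] at h'
  norm_num at h'
  obtain ⟨X, Y, h0⟩ := h'.eval_zero
  rw [Polynomial.eval_C] at h0
  set n := (conicMat a 1 b).toQuadraticForm' Y with hY
  have hn : n ≠ 0 := h0.value_ne_zero hτ hα
  have hX : (conicMat a 1 b).toQuadraticForm' (α • X) = n * (α * b₁) := by
    rw [QuadraticMap.map_smul, smul_eq_mul]
    linear_combination α * h0.2.2
  have hXY : (α • X) 1 * Y 2 + (α • X) 2 * Y 1 = n := by
    simp only [Pi.smul_apply, smul_eq_mul]
    linear_combination h0.2.1
  have hanis := conicMat_anisotropic_of_point hτ hn hX hY.symm hXY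
  have hanisT := anisotropic_map_C _ hanis
  have hanisk := anisotropic_map_algebraMap (K := FractionRing (Polynomial L)) _ hanisT
  have hτTU := anisotropic_map_C _ (anisotropic_map_C _ hτ)
  rw [conicMat_map, conicMat_map, map_one, map_one] at hτTU
  rw [conicMat_map, conicMat_map] at hanisk
  have hH := h.value_ne_zero hτTU (by simpa using hα)
  set ι : L →+* Polynomial (Polynomial L) := Polynomial.C.comp Polynomial.C with hι
  have hι' : ∀ c, Polynomial.C (Polynomial.C c) = ι c := fun c => rfl
  have hmap : ∀ v : Fin 3 → L, (conicMat (ι a) 1 (ι b)).toQuadraticForm' (fun i => ι (v i)) =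
      ι ((conicMat a 1 b).toQuadraticForm' v) := fun v => by
    rw [← map_toQuadraticForm'_apply, conicMat_map, map_one]
  obtain ⟨A, B₀, B₁, hAB⟩ := IsQuadraticPoint.norm_relation (n := ι n) (d := ι (α * b₁))
    (ν := ι n⁻¹) (g := Polynomial.C (Polynomial.C α * (Polynomial.C a₂ * Polynomial.X ^ 2 +
        Polynomial.X + Polynomial.C b₂)) * Polynomial.X ^ 2)
    CharTwo.two_eq_zero (by rw [← map_mul, mul_inv_cancel₀ hn, map_one])
    (X := fun i => ι ((α • X) i)) (Y := fun i => ι (Y i))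
    (by rw [hι', hι', hmap, hX, map_mul]) (by rw [hι', hι', hmap])
    (by simp only [← map_mul, ← map_add, hXY])
    (by simp only [hι', map_mul]; simp only [hι, RingHom.comp_apply]; ring) h
  set H := (conicMat (Polynomial.C (Polynomial.C a)) 1
    (Polynomial.C (Polynomial.C b))).toQuadraticForm' y with hHdef
  set m := Polynomial.mapRingHom (algebraMap (Polynomial L) (FractionRing (Polynomial L))) with hm
  have hminj : Function.Injective m :=
    Polynomial.map_injective _ (IsFractionRing.injective _ _)
  have hABk := congrArg m hAB
  simp only [map_add, map_mul, map_pow, hι, RingHom.comp_apply] at hABk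
  obtain ⟨p, q, hpq⟩ := exists_norm_eq_of_rational_solution
    (n := algebraMap (Polynomial L) (FractionRing (Polynomial L)) (Polynomial.C n))
    (d := algebraMap (Polynomial L) (FractionRing (Polynomial L)) (Polynomial.C (α * b₁)))
    (g := algebraMap (Polynomial L) (FractionRing (Polynomial L)) (Polynomial.C α *
      (Polynomial.C a₂ * Polynomial.X ^ 2 + Polynomial.X + Polynomial.C b₂)))
    (by simpa using hanisk) (A := m A) (B₀ := m B₀) (B₁ := m B₁) (h := m H)
    ((map_ne_zero_iff m hminj).2 hH) (by simpa [hm] using hABk)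
  obtain ⟨p₁, p₂, hp₂, rfl⟩ := IsFractionRing.div_surjective (A := Polynomial L) p
  obtain ⟨q₁, q₂, hq₂, rfl⟩ := IsFractionRing.div_surjective (A := Polynomial L) q
  have hp₂' := nonZeroDivisors.ne_zero hp₂
  have hq₂' := nonZeroDivisors.ne_zero hq₂
  refine artinSchreier_of_norm_eq hα (planeMat_anisotropic_of_conicMat hanis)
    (B₀ := p₁ * q₂) (B₁ := q₁ * p₂) (h := p₂ * q₂) (mul_ne_zero hp₂' hq₂') ?_
  apply IsFractionRing.injective (Polynomial L) (FractionRing (Polynomial L))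
  have hp₃ : algebraMap (Polynomial L) (FractionRing (Polynomial L)) p₂ ≠ 0 := by simpa using hp₂'
  have hq₃ : algebraMap (Polynomial L) (FractionRing (Polynomial L)) q₂ ≠ 0 := by simpa using hq₂'
  field_simp at hpq
  simp only [map_add, map_mul, map_pow] at hpq ⊢
  linear_combination hpq

end QuadraticPoint

section SquareSpan

variable {F : Type} [Field F] [CharP F 2]

/-- The subfield `F²(x, y)` of a field `F` of characteristic two. -/
def squareSpan (x y : F) : Subfield F where
  carrier := {l | ∃ t₀ t₁ t₂ t₃, l = t₀ ^ 2 + x * t₁ ^ 2 + y * t₂ ^ 2 + x * y * t₃ ^ 2}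
  mul_mem' := by
    rintro _ _ ⟨t₀, t₁, t₂, t₃, rfl⟩ ⟨s₀, s₁, s₂, s₃, rfl⟩
    refine ⟨t₀ * s₀ + x * t₁ * s₁ + y * t₂ * s₂ + x * y * t₃ * s₃,
      t₀ * s₁ + t₁ * s₀ + y * (t₂ * s₃ + t₃ * s₂), t₀ * s₂ + t₂ * s₀ + x * (t₁ * s₃ + t₃ * s₁),
      t₀ * s₃ + t₃ * s₀ + t₁ * s₂ + t₂ * s₁, ?_⟩
    simp only [CharTwo.add_sq]
    linear_combination (-(x * y ^ 2 * t₂ * t₃ * s₂ * s₃ + x ^ 2 * y * t₁ * t₃ * s₁ * s₃)) *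
      (CharTwo.two_eq_zero : (2 : F) = 0)
  one_mem' := ⟨1, 0, 0, 0, by simp⟩
  add_mem' := by
    rintro _ _ ⟨t₀, t₁, t₂, t₃, rfl⟩ ⟨s₀, s₁, s₂, s₃, rfl⟩
    refine ⟨t₀ + s₀, t₁ + s₁, t₂ + s₂, t₃ + s₃, ?_⟩
    simp only [CharTwo.add_sq]
    ring
  zero_mem' := ⟨0, 0, 0, 0, by simp⟩
  neg_mem' := by
    rintro _ ⟨t₀, t₁, t₂, t₃, rfl⟩
    exact ⟨t₀, t₁, t₂, t₃, CharTwo.neg_eq _⟩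
  inv_mem' := by
    rintro l ⟨t₀, t₁, t₂, t₃, h⟩
    refine ⟨t₀ * l⁻¹, t₁ * l⁻¹, t₂ * l⁻¹, t₃ * l⁻¹, ?_⟩
    by_cases hl : l = 0
    · simp [hl]
    · field_simp
      linear_combination h

/-- The Frobenius of `F`, with values in `F²(x, y)`. -/
def toSquareSpan (x y : F) : F →+* squareSpan x y :=
  (frobenius F 2).codRestrict (squareSpan x y) fun f => ⟨f, 0, 0, 0, by simp [frobenius_def]⟩

@[simp]
theorem coe_toSquareSpan (x y f : F) : (toSquareSpan x y f : F) = f ^ 2 := rfl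

theorem sq_eq_toSquareSpan {x y : F} (l : squareSpan x y) :
    l ^ 2 = toSquareSpan x y (l : F) := by
  ext; simp

theorem left_mem_squareSpan (x y : F) : x ∈ squareSpan x y := ⟨0, 1, 0, 0, by simp⟩

theorem right_mem_squareSpan (x y : F) : y ∈ squareSpan x y := ⟨0, 0, 1, 0, by simp⟩

/-- The values of `[a,b] ⊥ ⟨1,x,y⟩`. -/
def quinaryForm {R : Type*} [CommRing R] (a b x y : R) (v : Fin 5 → R) : R :=
  a * v 0 ^ 2 + v 0 * v 1 + b * v 1 ^ 2 + v 2 ^ 2 + x * v 3 ^ 2 + y * v 4 ^ 2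

theorem binQF_apply {R : Type} [CommRing R] (a b : R) (v : Fin 2 → R) :
    binQF a b v = a * v 0 ^ 2 + v 0 * v 1 + b * v 1 ^ 2 := by
  have h := planeMat_apply a 1 b v
  rw [one_mul] at h
  exact h

theorem pfisterQF_two_apply {R : Type} [CommRing R] (a : Fin 2 → R) (c : R)
    (w : Finset (Fin 2) → Fin 2 → R) :
    pfisterQF 2 a c w = binQF 1 c (w ∅) + a 0 * binQF 1 c (w {0}) + a 1 * binQF 1 c (w {1}) +
      a 0 * a 1 * binQF 1 c (w {0, 1}) := by
  have hu : (Finset.univ : Finset (Finset (Fin 2))) = {∅, {0}, {1}, {0, 1}} := by decide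
  rw [pfisterQF, QuadraticMap.pi_apply, hu, Finset.sum_insert (by decide),
    Finset.sum_insert (by decide), Finset.sum_insert (by decide), Finset.sum_singleton]
  simp
  ring

/-- If `[a,b]` represents an element of `F²(x, y)`, then `[a,b] ⊥ ⟨1,x,y⟩` is dominated by a
Pfister form with slots `x`, `y`. -/
theorem exists_pfister_of_mem_squareSpan {a b x y : F}
    (hanis : ∀ v, quinaryForm a b x y v = 0 → v = 0) {w₀ w₁ : F} (hw : w₀ ≠ 0 ∨ w₁ ≠ 0)
    (hmem : a * w₀ ^ 2 + w₀ * w₁ + b * w₁ ^ 2 ∈ squareSpan x y) :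
    ∃ (d : F) (f : (Fin 5 → F) →ₗ[F] (Finset (Fin 2) → Fin 2 → F)),
      ∀ v, quinaryForm a b x y v = pfisterQF 2 ![x, y] d (f v) := by
  have h2 : (2 : F) = 0 := CharTwo.two_eq_zero
  obtain ⟨t₀, t₁, t₂, t₃, ht⟩ := hmem
  have hx : x ≠ 0 := by
    rintro rfl
    simpa using congrFun (hanis ![0, 0, 0, 1, 0] (by simp [quinaryForm])) 3
  have hy : y ≠ 0 := by
    rintro rfl
    simpa using congrFun (hanis ![0, 0, 0, 0, 1] (by simp [quinaryForm])) 4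
  have ht₃ : t₃ ≠ 0 := by
    rintro rfl
    have h := hanis ![w₀, w₁, t₀, t₁, t₂] (by
      simp only [quinaryForm, Matrix.cons_val]
      linear_combination ht + (t₀ ^ 2 + x * t₁ ^ 2 + y * t₂ ^ 2) * h2)
    rcases hw with hw | hw
    · exact hw (congrFun h 0)
    · exact hw (congrFun h 1)
  obtain ⟨u₀, u₁, hu⟩ : ∃ u₀ u₁, w₀ * u₁ + w₁ * u₀ = 1 := by
    rcases hw with hw | hw
    · exact ⟨0, w₀⁻¹, by simp [hw]⟩
    · exact ⟨w₁⁻¹, 0, by simp [hw]⟩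
  let f : (Fin 5 → F) →ₗ[F] (Finset (Fin 2) → Fin 2 → F) :=
    LinearMap.pi fun S => LinearMap.pi fun j =>
      let α : (Fin 5 → F) →ₗ[F] F := u₁ • LinearMap.proj 0 + u₀ • LinearMap.proj 1
      let γ : (Fin 5 → F) →ₗ[F] F := w₁ • LinearMap.proj 0 + w₀ • LinearMap.proj 1
      if S = {0, 1} then (if j = 0 then t₃ • α else (x * y * t₃)⁻¹ • γ)
      else if j = 1 then 0
      else if S = ∅ then LinearMap.proj 2 + t₀ • α
      else if S = {0} then LinearMap.proj 3 + t₁ • α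
      else LinearMap.proj 4 + t₂ • α
  refine ⟨(a * u₀ ^ 2 + u₀ * u₁ + b * u₁ ^ 2) * (x * y * t₃ ^ 2), f, fun v => ?_⟩
  have f00 : f v ∅ 0 = v 2 + t₀ * (u₁ * v 0 + u₀ * v 1) := rfl
  have f01 : f v ∅ 1 = 0 := rfl
  have f10 : f v {0} 0 = v 3 + t₁ * (u₁ * v 0 + u₀ * v 1) := rfl
  have f11 : f v {0} 1 = 0 := rfl
  have f20 : f v {1} 0 = v 4 + t₂ * (u₁ * v 0 + u₀ * v 1) := rfl
  have f21 : f v {1} 1 = 0 := rfl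
  have f30 : f v {0, 1} 0 = t₃ * (u₁ * v 0 + u₀ * v 1) := rfl
  have f31 : f v {0, 1} 1 = (x * y * t₃)⁻¹ * (w₁ * v 0 + w₀ * v 1) := rfl
  obtain ⟨A, hA⟩ : ∃ A, A = u₁ * v 0 + u₀ * v 1 := ⟨_, rfl⟩
  obtain ⟨C, hC⟩ : ∃ C, C = w₁ * v 0 + w₀ * v 1 := ⟨_, rfl⟩
  have hv0 : v 0 = A * w₀ + C * u₀ := by
    rw [hA, hC]; linear_combination (-v 0) * hu - w₀ * u₀ * v 1 * h2
  have hv1 : v 1 = A * w₁ + C * u₁ := by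
    rw [hA, hC]; linear_combination (-v 1) * hu - w₁ * u₁ * v 0 * h2
  rw [← hA] at f00 f10 f20 f30
  rw [← hC] at f31
  rw [pfisterQF_two_apply]
  simp only [binQF_apply, f00, f01, f10, f11, f20, f21, f30, f31, quinaryForm, Matrix.cons_val]
  rw [hv0, hv1]
  field_simp
  linear_combination A ^ 2 * ht + A * C * hu + (A * C * (a * w₀ * u₀ + b * w₁ * u₁) -
    A * (t₀ * v 2 + x * t₁ * v 3 + y * t₂ * v 4)) * h2

/-- If `[a²,b²] ⊥ ⟨1⟩` is isotropic over `F²(x, y)`, then `[a,b]` represents an element of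
`F²(x, y)`. -/
theorem exists_mem_squareSpan {a b x y : F}
    (h : ¬ (conicMat (toSquareSpan x y a) 1 (toSquareSpan x y b)).toQuadraticForm'.Anisotropic) :
    ∃ w₀ w₁ : F, (w₀ ≠ 0 ∨ w₁ ≠ 0) ∧ a * w₀ ^ 2 + w₀ * w₁ + b * w₁ ^ 2 ∈ squareSpan x y := by
  have h2 : (2 : F) = 0 := CharTwo.two_eq_zero
  simp only [QuadraticMap.Anisotropic, not_forall] at h
  obtain ⟨v, hv, hv0⟩ := h
  rw [conicMat_apply] at hv
  have hvF := congrArg (Subtype.val : squareSpan x y → F) hv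
  simp at hvF
  by_cases h₂ : (v 2 : F) = 0
  · have h₁ : (v 1 : F) ≠ 0 := by
      intro h₁
      apply hv0
      rw [h₁, h₂] at hvF
      ext i
      fin_cases i
      · simpa using hvF
      · simpa using h₁
      · simpa using h₂
    refine ⟨1, 0, Or.inl one_ne_zero, ?_⟩
    have ha : a = v 0 / v 1 := by
      rw [eq_div_iff h₁, ← CharTwo.add_eq_zero]
      rw [h₂] at hvF
      apply pow_eq_zero_iff (n := 2) two_ne_zero |>.1
      rw [CharTwo.add_sq]
      linear_combination hvF
    have := (v 0 / v 1).2
    simp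
    rw [ha]
    simpa using this
  · refine ⟨(v 0 / v 2 : F) + a * (v 1 / v 2) + b, 1, Or.inr one_ne_zero, ?_⟩
    have : a * ((v 0 / v 2 : F) + a * (v 1 / v 2) + b) ^ 2 +
        ((v 0 / v 2 : F) + a * (v 1 / v 2) + b) * 1 + b * 1 ^ 2 = v 0 / v 2 := by
      simp only [CharTwo.add_sq]
      field_simp
      linear_combination a * hvF + h2 * b * v 2 ^ 2
    rw [this]
    exact (v 0 / v 2).2

/-- The form `[a²,b²] ⊥ ⟨1⟩` stays anisotropic over `F²(x, y)` when a scalar multiple of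
`[a,b] ⊥ ⟨1,x,y⟩` is isometric to an anisotropic form that is not a Pfister neighbour. -/
theorem conicMat_toSquareSpan_anisotropic {φ : QuadraticForm F (Fin 5 → F)}
    (hφa : φ.Anisotropic) (hφpn : ¬ IsPfisterNeighbour φ) {a b c x y : F} (hc : c ≠ 0)
    (E : (Fin 5 → F) ≃ₗ[F] (Fin 5 → F)) (hE : ∀ v, φ (E v) = c * quinaryForm a b x y v) :
    (conicMat (toSquareSpan x y a) 1 (toSquareSpan x y b)).toQuadraticForm'.Anisotropic := by
  by_contra h
  obtain ⟨w₀, w₁, hw, hmem⟩ := exists_mem_squareSpan h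
  have hanis : ∀ v, quinaryForm a b x y v = 0 → v = 0 := fun v hv => by
    simpa using hφa (E v) (by rw [hE, hv, mul_zero])
  obtain ⟨d, f, hf⟩ := exists_pfister_of_mem_squareSpan hanis hw hmem
  have hx : x ≠ 0 := by
    rintro rfl
    simpa using congrFun (hanis ![0, 0, 0, 1, 0] (by simp [quinaryForm])) 3
  have hy : y ≠ 0 := by
    rintro rfl
    simpa using congrFun (hanis ![0, 0, 0, 0, 1] (by simp [quinaryForm])) 4
  refine hφpn ⟨2, ![Units.mk0 x hx, Units.mk0 y hy], d, by simp, (Units.mk0 c hc)⁻¹,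
    f ∘ₗ E.symm.toLinearMap, ?_, fun v => ?_⟩
  · rw [← LinearMap.ker_eq_bot, LinearMap.ker_eq_bot']
    intro v hv
    have h0 := hf (E.symm v)
    rw [show f (E.symm v) = 0 from hv, QuadraticMap.map_zero] at h0
    simpa using hanis _ h0
  · have h0 := hE (E.symm v)
    rw [LinearEquiv.apply_symm_apply] at h0
    have hxy : (fun i => ((![Units.mk0 x hx, Units.mk0 y hy] i : Fˣ) : F)) = ![x, y] := by
      ext i; fin_cases i <;> rfl
    rw [hxy]
    simp [h0, hc, hf]

end SquareSpan

section NormalForm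

variable {F : Type} [Field F]

theorem exists_quinaryForm {φ : QuadraticForm F (Fin 5 → F)} (hφa : φ.Anisotropic)
    (hφt : HasTypeRS φ 1 3) :
    ∃ (a b c x y : F) (E : (Fin 5 → F) ≃ₗ[F] (Fin 5 → F)), c ≠ 0 ∧
      ∀ v, φ (E v) = c * quinaryForm a b x y v := by
  obtain ⟨A, B, C, ⟨e⟩⟩ := hφt
  have hc : C 0 ≠ 0 := by
    intro hc
    have h := hφa (e.symm (0, Pi.single 0 1)) (by
      rw [e.symm.map_app, QuadraticMap.prod_apply, QuadraticMap.map_zero, diagQF,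
        QuadraticMap.weightedSumSquares_apply]
      simp [Fin.sum_univ_three, hc])
    have h' := congrArg e h
    rw [QuadraticMap.IsometryEquiv.apply_symm_apply, map_zero] at h'
    simpa using congrFun (congrArg Prod.snd h') 0
  let E₀ : (Fin 5 → F) ≃ₗ[F] ((Fin 1 → Fin 2 → F) × (Fin 3 → F)) :=
    { toFun := fun v => (fun _ => ![v 0, C 0 * v 1], ![v 2, v 3, v 4])
      invFun := fun w => ![w.1 0 0, (C 0)⁻¹ * w.1 0 1, w.2 0, w.2 1, w.2 2]
      map_add' := fun v w => by
        ext i j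
        · fin_cases j <;> simp [mul_add]
        · fin_cases i <;> simp
      map_smul' := fun r v => by
        ext i j
        · fin_cases j <;> simp [mul_left_comm]
        · fin_cases i <;> simp
      left_inv := fun v => by ext i; fin_cases i <;> simp [hc]
      right_inv := fun w => by
        ext i j
        · fin_cases i; fin_cases j <;> simp [hc]
        · fin_cases i <;> simp }
  refine ⟨A 0 / C 0, B 0 * C 0, C 0, C 1 / C 0, C 2 / C 0, E₀.trans e.symm.toLinearEquiv, hc,
    fun v => ?_⟩
  have h : φ ((E₀.trans e.symm.toLinearEquiv) v) =
      ((binsQF A B).prod (diagQF C)) (fun _ => ![v 0, C 0 * v 1], ![v 2, v 3, v 4]) :=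
    e.symm.map_app _
  rw [h, QuadraticMap.prod_apply, diagQF, QuadraticMap.weightedSumSquares_apply, binsQF,
    QuadraticMap.pi_apply]
  simp only [Fin.sum_univ_three, Finset.univ_unique, Finset.sum_singleton, binQF_apply,
    Matrix.cons_val, quinaryForm, Fin.default_eq_zero, smul_eq_mul]
  field_simp
  ring

/-- The values of `[a₁,b₁] ⊥ [a₂,b₂]`. -/
def quaternaryForm {R : Type*} [CommRing R] (a₁ b₁ a₂ b₂ : R) (v : Fin 4 → R) : R :=
  a₁ * v 0 ^ 2 + v 0 * v 1 + b₁ * v 1 ^ 2 + (a₂ * v 2 ^ 2 + v 2 * v 3 + b₂ * v 3 ^ 2)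

theorem exists_quaternaryForm {ψ : QuadraticForm F (Fin 4 → F)} (hψa : ψ.Anisotropic)
    (hψt : HasTypeRS ψ 2 0)
    (harf : ∀ a b : Fin 2 → F, ψ.Equivalent (binsQF a b) →
      (∑ i, a i * b i) ∉ ArtinSchreier F) :
    ∃ (a₁ b₁ a₂ b₂ : F) (E : (Fin 4 → F) ≃ₗ[F] (Fin 4 → F)), a₁ ≠ 0 ∧
      (∀ s, a₁ * b₁ + a₂ * b₂ ≠ s ^ 2 + s) ∧ ∀ v, ψ (E v) = quaternaryForm a₁ b₁ a₂ b₂ v := by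
  obtain ⟨A, B, C, ⟨e⟩⟩ := hψt
  let p : (binsQF A B).IsometryEquiv ((binsQF A B).prod (diagQF C)) :=
    { LinearEquiv.prodUnique.symm with
      map_app' := fun v => by
        simp [diagQF, QuadraticMap.weightedSumSquares_apply] }
  let e' := e.trans p.symm
  let E₀ : (Fin 4 → F) ≃ₗ[F] (Fin 2 → Fin 2 → F) :=
    { toFun := fun v => ![![v 0, v 1], ![v 2, v 3]]
      invFun := fun w => ![w 0 0, w 0 1, w 1 0, w 1 1]
      map_add' := fun v w => by
        ext i j
        fin_cases i <;> fin_cases j <;> simp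
      map_smul' := fun r v => by
        ext i j
        fin_cases i <;> fin_cases j <;> simp
      left_inv := fun v => by ext i; fin_cases i <;> simp
      right_inv := fun w => by
        ext i j
        fin_cases i <;> fin_cases j <;> simp }
  have hE : ∀ v, ψ ((E₀.trans e'.symm.toLinearEquiv) v) =
      quaternaryForm (A 0) (B 0) (A 1) (B 1) v := fun v => by
    have h : ψ ((E₀.trans e'.symm.toLinearEquiv) v) =
        binsQF A B ![![v 0, v 1], ![v 2, v 3]] := e'.symm.map_app _
    rw [h, binsQF, QuadraticMap.pi_apply]
    simp [Fin.sum_univ_two, binQF_apply, quaternaryForm]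
  refine ⟨A 0, B 0, A 1, B 1, E₀.trans e'.symm.toLinearEquiv, ?_, ?_, hE⟩
  · intro h0
    have h := hψa (E₀.trans e'.symm.toLinearEquiv ![1, 0, 0, 0])
      (by rw [hE]; simp [quaternaryForm, h0])
    simpa using congrFun ((LinearEquiv.map_eq_zero_iff _).1 h) 0
  · intro s hs
    exact harf A B ⟨e'⟩ ⟨s, by rw [← hs, Fin.sum_univ_two]⟩

end NormalForm

section ScalarExtension

theorem toQuadraticForm'_eq_zero_of_alternating {ι R : Type*} [Fintype ι] [DecidableEq ι]
    [CommRing R] {D : Matrix ι ι R} (h1 : ∀ i, D i i = 0) (h2 : ∀ i j, D i j + D j i = 0)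
    (w : ι → R) : D.toQuadraticForm' w = 0 := by
  rw [toQuadraticForm'_eq_sum, ← Finset.sum_product', Finset.univ_product_univ]
  refine Finset.sum_involution (fun p _ => p.swap) (fun p _ => ?_) (fun p _ hp h => hp ?_)
    (fun p _ => Finset.mem_univ _) fun p _ => Prod.swap_swap p
  · simp only [Prod.fst_swap, Prod.snd_swap]
    linear_combination w p.1 * w p.2 * h2 p.1 p.2
  · have : p.2 = p.1 := congrArg Prod.fst h
    rw [this, h1, zero_mul]

theorem sub_toQuadraticForm'_apply {ι R : Type*} [Fintype ι] [DecidableEq ι] [CommRing R]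
    (A B : Matrix ι ι R) (v : ι → R) :
    (A - B).toQuadraticForm' v = A.toQuadraticForm' v - B.toQuadraticForm' v := by
  simp [toQuadraticForm'_eq_sum, sub_mul, Finset.sum_sub_distrib]

theorem map_toQuadraticForm'_congr {ι R S : Type*} [Fintype ι] [DecidableEq ι] [CommRing R]
    [CommRing S] {M N : Matrix ι ι R} (h : ∀ v, M.toQuadraticForm' v = N.toQuadraticForm' v)
    (f : R →+* S) (w : ι → S) :
    (M.map f).toQuadraticForm' w = (N.map f).toQuadraticForm' w := by
  have hD : ∀ v, (M - N).toQuadraticForm' v = 0 := fun v => by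
    rw [sub_toQuadraticForm'_apply, h, sub_self]
  have hd : ∀ i, (M - N) i i = 0 := fun i => by
    have := hD (Pi.single i 1)
    simpa [toQuadraticForm'_eq_sum, Pi.single_apply] using this
  have ho : ∀ i j, (M - N) i j + (M - N) j i = 0 := fun i j => by
    by_cases hij : i = j
    · subst hij; rw [hd, add_zero]
    · have := hD (Pi.single i 1 + Pi.single j 1)
      simp [toQuadraticForm'_eq_sum, Pi.single_apply, mul_add,
        Finset.sum_add_distrib] at this
      have hi := hd i
      have hj := hd j
      simp at hi hj ⊢
      linear_combination this - hi - hj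
  rw [← sub_eq_zero, ← sub_toQuadraticForm'_apply]
  refine toQuadraticForm'_eq_zero_of_alternating (fun i => ?_) (fun i j => ?_) w
  · simpa using congrArg f (hd i)
  · simpa using congrArg f (ho i j)

theorem toQuadraticForm'_mulVec {ι R : Type*} [Fintype ι] [DecidableEq ι] [CommRing R]
    (M P : Matrix ι ι R) (w : ι → R) :
    M.toQuadraticForm' (P.mulVec w) = (P.transpose * M * P).toQuadraticForm' w := by
  simp only [Matrix.toQuadraticForm', LinearMap.BilinMap.toQuadraticMap_apply,
    Matrix.toLinearMap₂'_apply']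
  simp [← Matrix.mulVec_mulVec, Matrix.dotProduct_mulVec, Matrix.vecMul_transpose]

variable {F : Type} [Field F]

theorem coeffMat_apply {n : ℕ} (φ : QuadraticForm F (Fin n → F)) (v : Fin n → F) :
    (coeffMat F φ).toQuadraticForm' v = φ v := by
  have h : LinearMap.toMatrix₂' F (φ.toBilin (Pi.basisFun F (Fin n))) = coeffMat F φ := by
    ext i j
    have := φ.toBilin_apply (Pi.basisFun F (Fin n)) i j
    simp only [Pi.basisFun_apply] at this
    rw [LinearMap.toMatrix₂'_apply, this]
    rfl
  have h' := congrArg (· v) (φ.toQuadraticMap_toBilin (Pi.basisFun F (Fin n)))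
  rw [← h, Matrix.toQuadraticForm', Matrix.toLinearMap₂'_toMatrix']
  exact h'

theorem exists_extendQF_eq {n : ℕ} {φ : QuadraticForm F (Fin n → F)} {M : Matrix (Fin n) (Fin n) F}
    (E : (Fin n → F) ≃ₗ[F] (Fin n → F)) (hE : ∀ v, φ (E v) = M.toQuadraticForm' v) :
    ∃ P P' : Matrix (Fin n) (Fin n) F, P * P' = 1 ∧ P' * P = 1 ∧
      ∀ {S : Type} [CommRing S] (f : F →+* S) (w : Fin n → S),
        extendQF F f φ w = (M.map f).toQuadraticForm' ((P.map f).mulVec w) := by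
  refine ⟨LinearMap.toMatrix' E.symm.toLinearMap, LinearMap.toMatrix' E.toLinearMap, ?_, ?_,
    fun f w => ?_⟩
  · rw [← LinearMap.toMatrix'_comp, LinearEquiv.symm_comp, LinearMap.toMatrix'_id]
  · rw [← LinearMap.toMatrix'_comp, LinearEquiv.comp_symm, LinearMap.toMatrix'_id]
  · set P := LinearMap.toMatrix' E.symm.toLinearMap with hP
    rw [toQuadraticForm'_mulVec, ← Matrix.transpose_map, ← Matrix.map_mul, ← Matrix.map_mul]
    refine map_toQuadraticForm'_congr (fun v => ?_) f w
    rw [coeffMat_apply, ← toQuadraticForm'_mulVec, hP, LinearMap.toMatrix'_mulVec, ← hE]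
    simp

end ScalarExtension

section Descent

variable {F : Type} [Field F]

/-- The Gram matrix of `c·([a,b] ⊥ ⟨1,x,y⟩)`. -/
def quinaryMat {R : Type*} [CommRing R] (c a b x y : R) : Matrix (Fin 5) (Fin 5) R :=
  c • !![a, 1, 0, 0, 0; 0, b, 0, 0, 0; 0, 0, 1, 0, 0; 0, 0, 0, x, 0; 0, 0, 0, 0, y]

theorem map_quinaryMat_apply {R S : Type*} [CommRing R] [CommRing S] (f : R →+* S)
    (c a b x y : R) (w : Fin 5 → S) :
    ((quinaryMat c a b x y).map f).toQuadraticForm' w =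
      f c * quinaryForm (f a) (f b) (f x) (f y) w := by
  simp [toQuadraticForm'_eq_sum, quinaryMat, quinaryForm, Fin.sum_univ_five]
  ring

/-- The Gram matrix of `[a₁,b₁] ⊥ [a₂,b₂]`. -/
def quaternaryMat {R : Type*} [CommRing R] (a₁ b₁ a₂ b₂ : R) : Matrix (Fin 4) (Fin 4) R :=
  !![a₁, 1, 0, 0; 0, b₁, 0, 0; 0, 0, a₂, 1; 0, 0, 0, b₂]

theorem map_quaternaryMat_apply {R S : Type*} [CommRing R] [CommRing S] (f : R →+* S)
    (a₁ b₁ a₂ b₂ : R) (w : Fin 4 → S) :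
    ((quaternaryMat a₁ b₁ a₂ b₂).map f).toQuadraticForm' w =
      quaternaryForm (f a₁) (f b₁) (f a₂) (f b₂) w := by
  simp [toQuadraticForm'_eq_sum, quaternaryMat, quaternaryForm, Fin.sum_univ_four]
  ring

theorem map_quinaryForm {R S : Type*} [CommRing R] [CommRing S] (f : R →+* S) (a b x y : R)
    (v : Fin 5 → R) :
    f (quinaryForm a b x y v) = quinaryForm (f a) (f b) (f x) (f y) fun i => f (v i) := by
  simp [quinaryForm]

theorem map_quaternaryForm {R S : Type*} [CommRing R] [CommRing S] (f : R →+* S)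
    (a₁ b₁ a₂ b₂ : R) (v : Fin 4 → R) :
    f (quaternaryForm a₁ b₁ a₂ b₂ v) =
      quaternaryForm (f a₁) (f b₁) (f a₂) (f b₂) fun i => f (v i) := by
  simp [quaternaryForm]

theorem quinaryForm_smul {R : Type*} [CommRing R] (a b x y r : R) (v : Fin 5 → R) :
    quinaryForm a b x y (r • v) = r ^ 2 * quinaryForm a b x y v := by
  simp only [quinaryForm, Pi.smul_apply, smul_eq_mul]
  ring

/-- A linear change of variables straightening the polynomial of a quadratic form. -/
theorem exists_algHom_qfPoly {ψ : QuadraticForm F (Fin 4 → F)} {a₁ b₁ a₂ b₂ : F}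
    (E : (Fin 4 → F) ≃ₗ[F] (Fin 4 → F)) (hE : ∀ v, ψ (E v) = quaternaryForm a₁ b₁ a₂ b₂ v) :
    ∃ θ η : MvPolynomial (Fin 4) F →ₐ[F] MvPolynomial (Fin 4) F, (∀ p, η (θ p) = p) ∧
      θ (qfPoly F ψ) = quaternaryForm (C a₁) (C b₁) (C a₂) (C b₂) X ∧
      η (quaternaryForm (C a₁) (C b₁) (C a₂) (C b₂) X) = qfPoly F ψ := by
  obtain ⟨P, P', hPP', hP'P, h⟩ := exists_extendQF_eq (M := quaternaryMat a₁ b₁ a₂ b₂) E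
    fun v => by
      rw [hE]
      simpa using (map_quaternaryMat_apply (RingHom.id F) a₁ b₁ a₂ b₂ v).symm
  let θ : MvPolynomial (Fin 4) F →ₐ[F] MvPolynomial (Fin 4) F :=
    aeval ((P'.map C).mulVec X)
  let η : MvPolynomial (Fin 4) F →ₐ[F] MvPolynomial (Fin 4) F :=
    aeval ((P.map C).mulVec X)
  have hC : ∀ (g : MvPolynomial (Fin 4) F →ₐ[F] MvPolynomial (Fin 4) F) r, g (C r) = C r :=
    fun g r => g.commutes r
  have hmv : ∀ (g : MvPolynomial (Fin 4) F →ₐ[F] MvPolynomial (Fin 4) F)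
      (A : Matrix (Fin 4) (Fin 4) F) (v : Fin 4 → MvPolynomial (Fin 4) F),
      (fun i => g ((A.map C).mulVec v i)) = (A.map C).mulVec fun i => g (v i) := by
    intro g A v
    ext1 i
    simp only [Matrix.mulVec, dotProduct, Matrix.map_apply, map_sum, map_mul, hC]
  have hq : qfPoly F ψ = quaternaryForm (C a₁) (C b₁) (C a₂) (C b₂) ((P.map C).mulVec X) := by
    rw [← map_quaternaryMat_apply, ← h C X, extendQF]
    exact (toQuadraticForm'_eq_sum _ _).symm
  have hθX : (fun i => θ (X i)) = (P'.map C).mulVec X := by ext1 i; simp [θ]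
  have hηX : (fun i => η (X i)) = (P.map C).mulVec X := by ext1 i; simp [η]
  have hcomp : ∀ A B : Matrix (Fin 4) (Fin 4) F, A * B = 1 →
      (A.map C).mulVec ((B.map C).mulVec X) = (X : Fin 4 → MvPolynomial (Fin 4) F) := by
    intro A B hAB
    rw [Matrix.mulVec_mulVec, ← Matrix.map_mul, hAB, Matrix.map_one _ C_0 C_1, Matrix.one_mulVec]
  refine ⟨θ, η, fun p => ?_, ?_, ?_⟩
  · have : η.comp θ = AlgHom.id F _ := by
      refine MvPolynomial.algHom_ext fun i => ?_
      have h1 := hmv η P' X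
      rw [hηX, hcomp _ _ hP'P] at h1
      have h2 := congrFun hθX i
      simp only [AlgHom.comp_apply, AlgHom.id_apply]
      rw [h2]
      exact congrFun h1 i
    exact DFunLike.congr_fun this p
  · rw [hq]
    have h1 := map_quaternaryForm θ.toRingHom (C a₁) (C b₁) (C a₂) (C b₂) ((P.map C).mulVec X)
    simp only [AlgHom.toRingHom_eq_coe, RingHom.coe_coe, hC, hmv, hθX, hcomp _ _ hPP'] at h1
    exact h1
  · have h1 := map_quaternaryForm η.toRingHom (C a₁) (C b₁) (C a₂) (C b₂) X
    simp only [AlgHom.toRingHom_eq_coe, RingHom.coe_coe, hC, hηX] at h1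
    rw [h1, hq]

theorem exists_dvd_quinaryForm {φ : QuadraticForm F (Fin 5 → F)}
    {ψ : QuadraticForm F (Fin 4 → F)} {a b c x y a₁ b₁ a₂ b₂ : F} (hc : c ≠ 0)
    (E : (Fin 5 → F) ≃ₗ[F] (Fin 5 → F)) (hE : ∀ v, φ (E v) = c * quinaryForm a b x y v)
    (E' : (Fin 4 → F) ≃ₗ[F] (Fin 4 → F)) (hE' : ∀ v, ψ (E' v) = quaternaryForm a₁ b₁ a₂ b₂ v)
    (h : ¬ (extendQF F (funFieldMap F ψ) φ).Anisotropic) :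
    ∃ Q : Fin 5 → MvPolynomial (Fin 4) F,
      quaternaryForm (C a₁) (C b₁) (C a₂) (C b₂) X ∣ quinaryForm (C a) (C b) (C x) (C y) Q ∧
      ∃ i, ¬ quaternaryForm (C a₁) (C b₁) (C a₂) (C b₂) X ∣ Q i := by
  simp only [QuadraticMap.Anisotropic, not_forall] at h
  obtain ⟨w, hw, hw0⟩ := h
  obtain ⟨P, P', hPP', hP'P, hP⟩ := exists_extendQF_eq (M := quinaryMat c a b x y) E
    fun v => by
      rw [hE]
      simpa using (map_quinaryMat_apply (RingHom.id F) c a b x y v).symm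
  set f := funFieldMap F ψ with hf
  rw [hP, map_quinaryMat_apply] at hw
  have hw1 : quinaryForm (f a) (f b) (f x) (f y) ((P.map f).mulVec w) = 0 := by
    have hu : f c⁻¹ * f c = 1 := by rw [← map_mul, inv_mul_cancel₀ hc, map_one]
    have := congrArg (f c⁻¹ * ·) hw
    simpa [← mul_assoc, hu] using this
  have hw2 : (P.map f).mulVec w ≠ 0 := by
    intro h0
    apply hw0
    have := congrArg ((P'.map f).mulVec ·) h0
    simpa [Matrix.mulVec_mulVec, ← Matrix.map_mul, hP'P] using this
  set u := (P.map f).mulVec w with hu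
  have : IsFractionRing (FunFieldRing F ψ) (FunField F ψ) :=
    inferInstanceAs (IsFractionRing (FunFieldRing F ψ) (FractionRing (FunFieldRing F ψ)))
  obtain ⟨s, hs⟩ := IsLocalization.exist_integer_multiples_of_finite
    (nonZeroDivisors (FunFieldRing F ψ)) u
  choose p hp using hs
  have hsu := IsLocalization.map_units (FunField F ψ) s
  set j := algebraMap (FunFieldRing F ψ) (FunField F ψ) with hj
  have hinj : Function.Injective j := IsFractionRing.injective _ _
  let mk : MvPolynomial (Fin 4) F →+* FunFieldRing F ψ :=
    Ideal.Quotient.mk (Ideal.span {qfPoly F ψ})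
  have hmk : ∀ q, mk q = 0 ↔ qfPoly F ψ ∣ q := fun q =>
    Ideal.Quotient.eq_zero_iff_mem.trans Ideal.mem_span_singleton
  have hfj : ∀ r, f r = j (mk (C r)) := fun r => rfl
  have hmksurj : Function.Surjective mk := Ideal.Quotient.mk_surjective
  choose q hq using fun i => hmksurj (p i)
  have hpu : (fun i => j (mk (q i))) = j s • u := by
    ext1 i
    rw [hq, hp, Algebra.smul_def, Pi.smul_apply, smul_eq_mul]
  have hQ : qfPoly F ψ ∣ quinaryForm (C a) (C b) (C x) (C y) q := by
    rw [← hmk]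
    apply hinj
    rw [map_quinaryForm, map_quinaryForm, ← hfj, ← hfj, ← hfj, ← hfj, hpu, quinaryForm_smul, hw1,
      mul_zero, map_zero]
  have hne : ∃ i, ¬ qfPoly F ψ ∣ q i := by
    by_contra! h0
    apply hw2
    have h1 : j s • u = 0 := by
      rw [← hpu]
      ext1 i
      rw [(hmk _).2 (h0 i), map_zero, Pi.zero_apply]
    ext1 i
    exact hsu.mul_right_eq_zero.1 (congrFun h1 i)
  obtain ⟨θ, η, hηθ, hθ, hη⟩ := exists_algHom_qfPoly E' hE'
  refine ⟨fun i => θ (q i), ?_, ?_⟩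
  · have h1 := map_dvd θ hQ
    have h2 := map_quinaryForm θ.toRingHom (C a) (C b) (C x) (C y) q
    have hC : ∀ r, θ (C r) = C r := fun r => θ.commutes r
    simp only [AlgHom.toRingHom_eq_coe, RingHom.coe_coe, hC] at h2
    rwa [h2, hθ] at h1
  · obtain ⟨i, hi⟩ := hne
    refine ⟨i, fun h0 => hi ?_⟩
    have h1 := map_dvd η h0
    rwa [hη, hηθ] at h1

end Descent

section QuadraticReduction

theorem quinaryForm_linear_relation {B : Type*} [CommRing B] [Nontrivial B] (h2 : (2 : B) = 0)
    {a b x y s t : B} {p₀ p₁ : Fin 5 → B}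
    (h : Polynomial.X ^ 2 + Polynomial.C s * Polynomial.X + Polynomial.C t ∣
      quinaryForm (Polynomial.C a) (Polynomial.C b) (Polynomial.C x) (Polynomial.C y)
        fun i => Polynomial.C (p₁ i) * Polynomial.X + Polynomial.C (p₀ i)) :
    p₀ 0 * p₁ 1 + p₀ 1 * p₁ 0 = quinaryForm a b x y p₁ * s ∧
      quinaryForm a b x y p₀ = quinaryForm a b x y p₁ * t := by
  have h2p : (2 : Polynomial B) = 0 := by
    rw [← map_ofNat (Polynomial.C : B →+* Polynomial B) 2, h2, map_zero]
  set m := Polynomial.X ^ 2 + Polynomial.C s * Polynomial.X + Polynomial.C t with hm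
  have hmm : m.Monic := by rw [hm]; monicity!
  have hmd : m.natDegree = 2 := by rw [hm]; compute_degree!
  have key : quinaryForm (Polynomial.C a) (Polynomial.C b) (Polynomial.C x) (Polynomial.C y)
        (fun i => Polynomial.C (p₁ i) * Polynomial.X + Polynomial.C (p₀ i)) -
        m * Polynomial.C (quinaryForm a b x y p₁) =
      Polynomial.C 0 * Polynomial.X ^ 2 +
        Polynomial.C (p₀ 0 * p₁ 1 + p₀ 1 * p₁ 0 - quinaryForm a b x y p₁ * s) * Polynomial.X +
        Polynomial.C (quinaryForm a b x y p₀ - quinaryForm a b x y p₁ * t) := by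
    simp only [quinaryForm, map_add, map_sub, map_mul, map_pow, map_zero, hm]
    linear_combination (Polynomial.C a * Polynomial.C (p₁ 0) * Polynomial.C (p₀ 0) +
      Polynomial.C b * Polynomial.C (p₁ 1) * Polynomial.C (p₀ 1) +
      Polynomial.C (p₁ 2) * Polynomial.C (p₀ 2) +
      Polynomial.C x * Polynomial.C (p₁ 3) * Polynomial.C (p₀ 3) +
      Polynomial.C y * Polynomial.C (p₁ 4) * Polynomial.C (p₀ 4)) * Polynomial.X * h2p
  have hdvd := dvd_sub h (Dvd.intro (Polynomial.C (quinaryForm a b x y p₁)) rfl : m ∣ _)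
  rw [key] at hdvd
  have hz := by_contra fun h0 => Polynomial.Monic.not_dvd_of_natDegree_lt hmm h0 (by
    rw [hmd, map_zero, zero_mul, zero_add]
    exact Nat.lt_succ_of_le Polynomial.natDegree_linear_le) hdvd
  obtain ⟨-, e1, e0⟩ := quadratic_eq_zero hz
  exact ⟨sub_eq_zero.1 e1, sub_eq_zero.1 e0⟩

theorem dvd_quinaryForm_of_dvd_sub {R : Type*} [CommRing R] {m a b x y : R} {u v : Fin 5 → R}
    (huv : ∀ i, m ∣ u i - v i) (hv : m ∣ quinaryForm a b x y v) : m ∣ quinaryForm a b x y u := by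
  have h : ∀ i, Ideal.Quotient.mk (Ideal.span {m}) (u i) =
      Ideal.Quotient.mk (Ideal.span {m}) (v i) := fun i => by
    rw [Ideal.Quotient.eq, Ideal.mem_span_singleton]
    exact huv i
  rw [← Ideal.mem_span_singleton, ← Ideal.Quotient.eq_zero_iff_mem, map_quinaryForm] at hv ⊢
  simpa only [h] using hv

/-- Writing an isotropic vector over the function field of `[a₁,b₁] ⊥ [a₂,b₂]` in the form
`p₀ + p₁·Z`, where `Z` is the first coordinate function. -/
theorem exists_polynomial_relation {F : Type} [Field F] [CharP F 2] {a b x y a₁ b₁ a₂ b₂ : F}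
    (ha₁ : a₁ ≠ 0) {Q : Fin 5 → MvPolynomial (Fin 4) F}
    (hQ : quaternaryForm (C a₁) (C b₁) (C a₂) (C b₂) X ∣ quinaryForm (C a) (C b) (C x) (C y) Q)
    (hne : ∃ i, ¬ quaternaryForm (C a₁) (C b₁) (C a₂) (C b₂) X ∣ Q i) :
    ∃ p₀ p₁ : Fin 5 → MvPolynomial (Fin 3) F, (p₀ ≠ 0 ∨ p₁ ≠ 0) ∧
      C a₁ * (p₀ 0 * p₁ 1 + p₀ 1 * p₁ 0) = quinaryForm (C a) (C b) (C x) (C y) p₁ * X 0 ∧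
      C a₁ * quinaryForm (C a) (C b) (C x) (C y) p₀ = quinaryForm (C a) (C b) (C x) (C y) p₁ *
        (C b₁ * X 0 ^ 2 + (C a₂ * X 1 ^ 2 + X 1 * X 2 + C b₂ * X 2 ^ 2)) := by
  set g := finSuccEquiv F 3 with hg
  have hgC : ∀ r, g (C r) = Polynomial.C (C r) := fun r => by
    rw [hg, finSuccEquiv_apply, eval₂Hom_C]; rfl
  have hgX : ∀ i : Fin 3, g (X i.succ) = Polynomial.C (X i) := fun i => finSuccEquiv_X_succ
  set s : MvPolynomial (Fin 3) F := C a₁⁻¹ * X 0 with hs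
  set t : MvPolynomial (Fin 3) F :=
    C a₁⁻¹ * (C b₁ * X 0 ^ 2 + (C a₂ * X 1 ^ 2 + X 1 * X 2 + C b₂ * X 2 ^ 2)) with ht
  have haa : (C a₁ : MvPolynomial (Fin 3) F) * C a₁⁻¹ = 1 := by
    rw [← C_mul, mul_inv_cancel₀ ha₁, C_1]
  set m := Polynomial.X ^ 2 + Polynomial.C s * Polynomial.X + Polynomial.C t with hm
  have hmm : m.Monic := by rw [hm]; monicity!
  have hmd : m.natDegree = 2 := by rw [hm]; compute_degree!
  have hgP : g (quaternaryForm (C a₁) (C b₁) (C a₂) (C b₂) X) = Polynomial.C (C a₁) * m := by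
    have hX1 : g (X 1) = Polynomial.C (X 0) := hgX 0
    have hX2 : g (X 2) = Polynomial.C (X 1) := hgX 1
    have hX3 : g (X 3) = Polynomial.C (X 2) := hgX 2
    have hX0 : g (X 0) = Polynomial.X := finSuccEquiv_X_zero
    have haP : (Polynomial.C (C a₁) : Polynomial (MvPolynomial (Fin 3) F)) *
        Polynomial.C (C a₁⁻¹) = 1 := by rw [← map_mul, haa, map_one]
    simp only [quaternaryForm, map_add, map_mul, map_pow, hgC, hX0, hX1, hX2, hX3, hm, hs, ht]
    linear_combination (-(Polynomial.C (X 0) * Polynomial.X) - (Polynomial.C (C b₁) *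
      Polynomial.C (X 0) ^ 2 + (Polynomial.C (C a₂) * Polynomial.C (X 1) ^ 2 + Polynomial.C (X 1) *
      Polynomial.C (X 2) + Polynomial.C (C b₂) * Polynomial.C (X 2) ^ 2))) * haP
  have hdvd : ∀ q, quaternaryForm (C a₁) (C b₁) (C a₂) (C b₂) X ∣ q ↔ m ∣ g q := by
    intro q
    rw [← map_dvd_iff g, hgP]
    refine IsUnit.mul_left_dvd (IsUnit.map Polynomial.C ?_)
    exact IsUnit.of_mul_eq_one _ haa
  set r : Fin 5 → Polynomial (MvPolynomial (Fin 3) F) := fun i => g (Q i) %ₘ m with hr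
  have hlin : ∀ i, r i = Polynomial.C ((r i).coeff 1) * Polynomial.X +
      Polynomial.C ((r i).coeff 0) := fun i => by
    refine Polynomial.eq_X_add_C_of_natDegree_le_one (Nat.le_of_lt_succ ?_)
    have h1 : m ≠ 1 := by
      intro h1; rw [h1, Polynomial.natDegree_one] at hmd; omega
    have := Polynomial.natDegree_modByMonic_lt (g (Q i)) hmm h1
    rwa [hmd] at this
  have hmr : m ∣ quinaryForm (Polynomial.C (C a)) (Polynomial.C (C b)) (Polynomial.C (C x))
      (Polynomial.C (C y)) r := by
    refine dvd_quinaryForm_of_dvd_sub (v := fun i => g (Q i)) (fun i => ?_) ?_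
    · rw [← dvd_neg, neg_sub]
      change m ∣ g (Q i) - g (Q i) %ₘ m
      rw [Polynomial.modByMonic_eq_sub_mul_div, sub_sub_cancel]
      exact dvd_mul_right _ _
    · have h1 := (hdvd _).1 hQ
      simpa only [quinaryForm, map_add, map_mul, map_pow, hgC] using h1
  rw [funext hlin] at hmr
  obtain ⟨h1, h0⟩ := quinaryForm_linear_relation CharTwo.two_eq_zero hmr
  refine ⟨fun i => (r i).coeff 0, fun i => (r i).coeff 1, ?_, ?_, ?_⟩
  · by_contra! hz
    obtain ⟨i, hi⟩ := hne
    refine hi ((hdvd _).2 ?_)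
    have := hlin i
    rw [show (r i).coeff 0 = 0 from congrFun hz.1 i, show (r i).coeff 1 = 0 from congrFun hz.2 i,
      map_zero, zero_mul, zero_add] at this
    exact (Polynomial.modByMonic_eq_zero_iff_dvd hmm).1 this
  · rw [h1, hs]
    linear_combination quinaryForm (C a) (C b) (C x) (C y) (fun i => (r i).coeff 1) * X 0 * haa
  · rw [h0, ht]
    linear_combination quinaryForm (C a) (C b) (C x) (C y) (fun i => (r i).coeff 1) *
      (C b₁ * X 0 ^ 2 + (C a₂ * X 1 ^ 2 + X 1 * X 2 + C b₂ * X 2 ^ 2)) * haa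

end QuadraticReduction

section BlowUp

/-- The substitution `(S, S·U·T, S·U)` on polynomials in three variables. -/
noncomputable def blowUp (L : Type*) [CommRing L] :
    MvPolynomial (Fin 3) L →+* Polynomial (Polynomial (Polynomial L)) :=
  eval₂Hom (S₁ := Polynomial (Polynomial (Polynomial L)))
    (Polynomial.C.comp (Polynomial.C.comp Polynomial.C))
    ![Polynomial.X, Polynomial.X * Polynomial.C Polynomial.X *
      Polynomial.C (Polynomial.C Polynomial.X), Polynomial.X * Polynomial.C Polynomial.X]

@[simp]
theorem blowUp_C {L : Type*} [CommRing L] (l : L) :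
    blowUp L (C l) = Polynomial.C (Polynomial.C (Polynomial.C l)) := by
  simp [blowUp]

theorem blowUp_X {L : Type*} [CommRing L] (i : Fin 3) : blowUp L (X i) =
    ![Polynomial.X, Polynomial.X * Polynomial.C Polynomial.X *
      Polynomial.C (Polynomial.C Polynomial.X), Polynomial.X * Polynomial.C Polynomial.X] i := by
  simp [blowUp]

theorem blowUp_injective (L : Type*) [Field L] : Function.Injective (blowUp L) := by
  let K := FractionRing (MvPolynomial (Fin 3) L)
  let ξ : Fin 3 → K := fun i => algebraMap (MvPolynomial (Fin 3) L) K (X i)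
  have hξ : ∀ i, ξ i ≠ 0 := fun i =>
    (map_ne_zero_iff _ (IsFractionRing.injective (MvPolynomial (Fin 3) L) K)).2 (X_ne_zero i)
  let φ : Polynomial (Polynomial (Polynomial L)) →+* K :=
    Polynomial.eval₂RingHom (Polynomial.eval₂RingHom
      (Polynomial.eval₂RingHom ((algebraMap (MvPolynomial (Fin 3) L) K).comp C) (ξ 1 / ξ 2))
      (ξ 2 / ξ 0)) (ξ 0)
  have h : φ.comp (blowUp L) = algebraMap (MvPolynomial (Fin 3) L) K := by
    refine MvPolynomial.ringHom_ext (fun r => ?_) fun i => ?_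
    · simp [φ]
    · have h0 := hξ 0
      have h2 := hξ 2
      fin_cases i
      · simp [φ, blowUp_X, ξ]
      · simp [φ, blowUp_X]
        rw [div_mul_cancel₀ _ h0, mul_div_cancel₀ _ h2]
      · simp [φ, blowUp_X]
        rw [div_mul_cancel₀ _ h0]
  refine Function.Injective.of_comp (f := φ) ?_
  rw [← RingHom.coe_comp, h]
  exact IsFractionRing.injective (MvPolynomial (Fin 3) L) K

end BlowUp

section FunctionField

variable {F : Type} [Field F]

theorem IsQuadraticPoint.exists_of_relation {R : Type*} [CommRing R] [IsDomain R] {a b α e : R}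
    {x y : Fin 3 → Polynomial R} (hxy : x ≠ 0 ∨ y ≠ 0)
    (h₁ : Polynomial.C α * (x 1 * y 2 + x 2 * y 1) =
      (conicMat (Polynomial.C a) 1 (Polynomial.C b)).toQuadraticForm' y * Polynomial.X)
    (h₀ : Polynomial.C α * (conicMat (Polynomial.C a) 1 (Polynomial.C b)).toQuadraticForm' x =
      (conicMat (Polynomial.C a) 1 (Polynomial.C b)).toQuadraticForm' y *
        (Polynomial.X ^ 2 * Polynomial.C e)) :
    ∃ u v, IsQuadraticPoint a b α e u v := by
  have hS : (conicMat (Polynomial.C a) 1 (Polynomial.C b)).toQuadraticForm'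
        ((Polynomial.X : Polynomial R) • y) =
      Polynomial.X ^ 2 * (conicMat (Polynomial.C a) 1 (Polynomial.C b)).toQuadraticForm' y := by
    rw [QuadraticMap.map_smul, smul_eq_mul, _root_.sq]
  obtain ⟨u, v, huv⟩ := IsQuadraticPoint.eval_zero (a := a) (b := b) (α := α)
    (e := Polynomial.C e) (x := x) (y := Polynomial.X • y)
    ⟨hxy.imp_right (smul_ne_zero Polynomial.X_ne_zero), by
      rw [hS]
      simp only [Pi.smul_apply, smul_eq_mul]
      linear_combination Polynomial.X * h₁, by
      rw [hS]
      linear_combination h₀⟩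
  rw [Polynomial.eval_C] at huv
  exact ⟨u, v, huv⟩

/-- `[f a,f b] ⊥ ⟨1⟩` evaluated at the vector obtained by extracting the square roots
`ξ`, `η` of `f x`, `f y`. -/
theorem conicMat_apply_sqrt {A B : Type*} [CommRing A] [CommRing B] (f : A →+* B)
    (h2 : (2 : B) = 0) {a b x y : A} {ξ η : B} (hξ : ξ ^ 2 = f x) (hη : η ^ 2 = f y)
    (v : Fin 5 → A) :
    (conicMat (f a) 1 (f b)).toQuadraticForm'
      ![f (v 2) + ξ * f (v 3) + η * f (v 4), f (v 0), f (v 1)] = f (quinaryForm a b x y v) := by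
  rw [conicMat_apply, map_quinaryForm]
  simp only [quinaryForm, Matrix.cons_val]
  linear_combination f (v 3) ^ 2 * hξ + f (v 4) ^ 2 * hη +
    (f (v 2) * ξ * f (v 3) + f (v 2) * η * f (v 4) + ξ * f (v 3) * η * f (v 4)) * h2

theorem sqrt_vector_ne_zero [CharP F 2] {σ : Type*} {a b x y : F}
    (hanis : ∀ v, quinaryForm a b x y v = 0 → v = 0) {p : Fin 5 → MvPolynomial σ F} (hp : p ≠ 0) :
    (![map (toSquareSpan x y) (p 2) +
        C ⟨x, left_mem_squareSpan x y⟩ * map (toSquareSpan x y) (p 3) +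
        C ⟨y, right_mem_squareSpan x y⟩ * map (toSquareSpan x y) (p 4),
      map (toSquareSpan x y) (p 0), map (toSquareSpan x y) (p 1)] :
        Fin 3 → MvPolynomial σ (squareSpan x y)) ≠ 0 := by
  intro h
  refine hp (funext fun j => MvPolynomial.ext _ _ fun d => ?_)
  have e0 := congrArg (fun q => ((coeff d q : squareSpan x y) : F)) (congrFun h 0)
  have e1 := congrArg (fun q => ((coeff d q : squareSpan x y) : F)) (congrFun h 1)
  have e2 := congrArg (fun q => ((coeff d q : squareSpan x y) : F)) (congrFun h 2)
  simp [coeff_map, coeff_C_mul] at e0 e1 e2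
  have := hanis (fun j => coeff d (p j)) (by
    simp only [quinaryForm, e1, e2]
    linear_combination e0)
  simpa using congrFun this j

theorem exists_isQuadraticPoint_of_ringHom {R : Type*} [CommRing R] [IsDomain R] [CharP R 2]
    {a b x y a₁ b₁ a₂ b₂ : F} {u t : R} {ξ η : Polynomial R} (j : F →+* R)
    (f : MvPolynomial (Fin 3) F →+* Polynomial R) (hfC : ∀ r, f (C r) = Polynomial.C (j r))
    (hf0 : f (X 0) = Polynomial.X) (hf1 : f (X 1) = Polynomial.X * Polynomial.C (u * t))
    (hf2 : f (X 2) = Polynomial.X * Polynomial.C u) (hξ : ξ ^ 2 = f (C x)) (hη : η ^ 2 = f (C y))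
    (hv : ∀ p : Fin 5 → MvPolynomial (Fin 3) F, p ≠ 0 →
      ![f (p 2) + ξ * f (p 3) + η * f (p 4), f (p 0), f (p 1)] ≠ 0)
    {p₀ p₁ : Fin 5 → MvPolynomial (Fin 3) F} (hp : p₀ ≠ 0 ∨ p₁ ≠ 0)
    (h₁ : C a₁ * (p₀ 0 * p₁ 1 + p₀ 1 * p₁ 0) = quinaryForm (C a) (C b) (C x) (C y) p₁ * X 0)
    (h₀ : C a₁ * quinaryForm (C a) (C b) (C x) (C y) p₀ =
      quinaryForm (C a) (C b) (C x) (C y) p₁ *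
        (C b₁ * X 0 ^ 2 + (C a₂ * X 1 ^ 2 + X 1 * X 2 + C b₂ * X 2 ^ 2))) :
    ∃ p q : Fin 3 → R,
      IsQuadraticPoint (j a) (j b) (j a₁) (j b₁ + (j a₂ * t ^ 2 + t + j b₂) * u ^ 2) p q := by
  have hq : ∀ p, (conicMat (f (C a)) 1 (f (C b))).toQuadraticForm'
      ![f (p 2) + ξ * f (p 3) + η * f (p 4), f (p 0), f (p 1)] =
      f (quinaryForm (C a) (C b) (C x) (C y) p) := fun p =>
    conicMat_apply_sqrt (a := C a) (b := C b) f CharTwo.two_eq_zero hξ hη p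
  rw [hfC, hfC] at hq
  have g₁ := congrArg f h₁
  have g₀ := congrArg f h₀
  rw [map_mul, map_mul, ← hq p₁] at g₁
  rw [map_mul, map_mul, ← hq p₁, ← hq p₀] at g₀
  simp only [map_add, map_mul, map_pow, hfC, hf0, hf1, hf2] at g₁ g₀
  refine IsQuadraticPoint.exists_of_relation (hp.imp (hv p₀) (hv p₁)) g₁ ?_
  rw [g₀]
  simp only [map_add, map_mul, map_pow]
  ring

/-- An isotropic vector of `[a,b] ⊥ ⟨1,x,y⟩` over the function field of `[a₁,b₁] ⊥ [a₂,b₂]`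
gives a quadratic point of the conic `[i a,i b] ⊥ ⟨1⟩` over `L(U, T)`, when `i x` and `i y` are
squares in `L`. -/
theorem exists_isQuadraticPoint {L : Type*} [Field L] [CharP L 2] (i : F →+* L)
    {a b x y a₁ b₁ a₂ b₂ : F} {ξ₀ η₀ : L} (hξ₀ : ξ₀ ^ 2 = i x) (hη₀ : η₀ ^ 2 = i y)
    (hv : ∀ p : Fin 5 → MvPolynomial (Fin 3) F, p ≠ 0 →
      ![map i (p 2) + C ξ₀ * map i (p 3) + C η₀ * map i (p 4), map i (p 0), map i (p 1)] ≠ 0)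
    {p₀ p₁ : Fin 5 → MvPolynomial (Fin 3) F} (hp : p₀ ≠ 0 ∨ p₁ ≠ 0)
    (h₁ : C a₁ * (p₀ 0 * p₁ 1 + p₀ 1 * p₁ 0) = quinaryForm (C a) (C b) (C x) (C y) p₁ * X 0)
    (h₀ : C a₁ * quinaryForm (C a) (C b) (C x) (C y) p₀ =
      quinaryForm (C a) (C b) (C x) (C y) p₁ *
        (C b₁ * X 0 ^ 2 + (C a₂ * X 1 ^ 2 + X 1 * X 2 + C b₂ * X 2 ^ 2))) :
    ∃ u v : Fin 3 → Polynomial (Polynomial L),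
      IsQuadraticPoint (Polynomial.C (Polynomial.C (i a))) (Polynomial.C (Polynomial.C (i b)))
        (Polynomial.C (Polynomial.C (i a₁)))
        (Polynomial.C (Polynomial.C (i b₁)) + Polynomial.C (Polynomial.C (i a₂) *
          Polynomial.X ^ 2 + Polynomial.X + Polynomial.C (i b₂)) * Polynomial.X ^ 2) u v := by
  let f : MvPolynomial (Fin 3) F →+* Polynomial (Polynomial (Polynomial L)) :=
    (blowUp L).comp (map i)
  let j : F →+* Polynomial (Polynomial L) := Polynomial.C.comp (Polynomial.C.comp i)
  have hj : ∀ r, j r = Polynomial.C (Polynomial.C (i r)) := fun r => rfl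
  have hfC : ∀ r, f (C r) = Polynomial.C (j r) := fun r => by simp [f, j]
  have hf0 : f (X 0) = Polynomial.X := by simp [f, blowUp_X]
  have hf1 : f (X 1) = Polynomial.X * Polynomial.C (Polynomial.X * Polynomial.C Polynomial.X) := by
    simp [f, blowUp_X]
    ring
  have hf2 : f (X 2) = Polynomial.X * Polynomial.C Polynomial.X := by simp [f, blowUp_X]
  have hξ : (blowUp L (C ξ₀)) ^ 2 = f (C x) := by simp [f, ← map_pow, hξ₀]
  have hη : (blowUp L (C η₀)) ^ 2 = f (C y) := by simp [f, ← map_pow, hη₀]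
  have hw : ∀ p : Fin 5 → MvPolynomial (Fin 3) F, p ≠ 0 →
      ![f (p 2) + blowUp L (C ξ₀) * f (p 3) + blowUp L (C η₀) * f (p 4), f (p 0), f (p 1)] ≠ 0 :=
    fun p hp h => by
      refine hv p hp (funext fun k => blowUp_injective _ ?_)
      refine Eq.trans ?_ ((congrFun h k).trans (map_zero _).symm)
      fin_cases k <;> simp [f]
  clear_value f
  have key := exists_isQuadraticPoint_of_ringHom j f hfC hf0 hf1 hf2 hξ hη hw hp h₁ h₀
  simp only [hj] at key
  obtain ⟨u, v, huv⟩ := key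
  refine ⟨u, v, ?_⟩
  simpa only [map_add, map_mul, map_pow] using huv

end FunctionField

theorem stmt2 (F : Type) [Field F] [CharP F 2]
    (φ : QuadraticForm F (Fin 5 → F)) (hφa : φ.Anisotropic) (hφt : HasTypeRS φ 1 3)
    (hφpn : ¬ IsPfisterNeighbour φ)
    (ψ : QuadraticForm F (Fin 4 → F)) (hψa : ψ.Anisotropic) (hψt : HasTypeRS ψ 2 0)
    (harf : ∀ a b : Fin 2 → F, ψ.Equivalent (binsQF a b) →
      (∑ i, a i * b i) ∉ ArtinSchreier F) :
    (extendQF F (funFieldMap F ψ) φ).Anisotropic := by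
  by_contra hiso
  obtain ⟨a, b, c, x, y, E, hc, hE⟩ := exists_quinaryForm hφa hφt
  obtain ⟨a₁, b₁, a₂, b₂, E', ha₁, hδ, hE'⟩ := exists_quaternaryForm hψa hψt harf
  obtain ⟨Q, hQ, hne⟩ := exists_dvd_quinaryForm hc E hE E' hE' hiso
  obtain ⟨p₀, p₁, hp, h₁, h₀⟩ := exists_polynomial_relation ha₁ hQ hne
  have hanis : ∀ v, quinaryForm a b x y v = 0 → v = 0 := fun v hv => by
    simpa using hφa (E v) (by rw [hE, hv, mul_zero])
  obtain ⟨u, v, huv⟩ := exists_isQuadraticPoint (toSquareSpan x y)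
    (sq_eq_toSquareSpan ⟨x, left_mem_squareSpan x y⟩)
    (sq_eq_toSquareSpan ⟨y, right_mem_squareSpan x y⟩)
    (fun p hp => sqrt_vector_ne_zero hanis hp) hp h₁ h₀
  obtain ⟨s, hs⟩ := huv.artinSchreier
    (conicMat_toSquareSpan_anisotropic hφa hφpn hc E hE) ((map_ne_zero _).2 ha₁)
  have hsF := congrArg (Subtype.val : squareSpan x y → F) hs
  simp at hsF
  refine hδ (a₁ * b₁ + a₂ * b₂ + s) ?_
  rw [CharTwo.add_sq, CharTwo.add_sq]
  linear_combination -hsF - ((s : F) + (s : F) ^ 2) * (CharTwo.two_eq_zero : (2 : F) = 0)
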